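/- arXiv:1109.3057 — 3 statements merged into one kernel-verified Lean document; each statement's English description precedes it below -/
import Mathlib

section
/- Let A and B be positive semidefinite n×n complex matrices and let p ≥ 1 be a real number. Then Tr(((A^p + B^p)/2)^{1/p}) ≥ 2^{1-1/p}·Tr((A+B)/2) + (1 - 2^{1-1/p})·Tr(A^{1/2}·B^{1/2}). -/
open ComplexOrder

/-- For a positive semidefinite matrix `M` and `q : ℝ`, the matrix power `M^q`
via the continuous functional calculus (applying `x ↦ x^q` to the eigenvalues). -/
noncomputable def matrixRpow {n : ℕ} (M : Matrix (Fin n) (Fin n) ℂ) (q : ℝ) :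
    Matrix (Fin n) (Fin n) ℂ :=
  cfc (fun x : ℝ => x ^ q) M


lemma aux1 (q : ℝ) (h0 : 0 < q) (h1 : q < 1) (s : ℝ) (hs : 0 < s) (hs2 : s ≤ 1/2) :
    (1-s)^q - (1-s) ≤ s^q - s := by
  have hc : ConcaveOn ℝ (Set.Icc (0:ℝ) (1/2)) (fun s : ℝ => s^q - s - ((1-s)^q - (1-s))) := by
    have hd : ∀ s ∈ Set.Ioo (0:ℝ) (1/2), HasDerivAt (fun s : ℝ => s^q - s - ((1-s)^q - (1-s)))
        (q * (s^(q-1) + (1-s)^(q-1)) - 2) s := by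
      intro s hs
      have e1 := Real.hasDerivAt_rpow_const (x := s) (p := q) (Or.inl hs.1.ne')
      have e2 := (Real.hasDerivAt_rpow_const (x := 1 - s) (p := q)
        (Or.inl (by linarith [hs.2]))).comp s ((hasDerivAt_id s).const_sub 1)
      have e3 := (e1.sub (hasDerivAt_id s)).sub (e2.sub ((hasDerivAt_id s).const_sub 1))
      refine HasDerivAt.congr_deriv e3 ?_
      ring
    have hd2 : ∀ s ∈ Set.Ioo (0:ℝ) (1/2), HasDerivAt (fun s : ℝ => q * (s^(q-1) + (1-s)^(q-1)) - 2)
        (q * ((q-1) * (s^(q-1-1) - (1-s)^(q-1-1)))) s := by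
      intro s hs
      have e1 := Real.hasDerivAt_rpow_const (x := s) (p := q-1) (Or.inl hs.1.ne')
      have e2 := (Real.hasDerivAt_rpow_const (x := 1 - s) (p := q-1)
        (Or.inl (by linarith [hs.2]))).comp s ((hasDerivAt_id s).const_sub 1)
      have e3 := ((e1.add e2).const_mul q).sub_const 2
      refine HasDerivAt.congr_deriv e3 ?_
      ring
    refine concaveOn_of_hasDerivWithinAt2_nonpos (f' := fun s : ℝ => (q * (s^(q-1) + (1-s)^(q-1)) - 2)) (f'' := fun s : ℝ => q * ((q-1) * (s^(q-1-1) - (1-s)^(q-1-1)))) (convex_Icc _ _) ?_ ?_ ?_ ?_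
    · have c1 : Continuous (fun s : ℝ => s ^ q) := Real.continuous_rpow_const h0.le
      have c2 : Continuous (fun s : ℝ => (1 - s) ^ q) := c1.comp (by fun_prop)
      exact Continuous.continuousOn (by fun_prop)
    · rw [interior_Icc]; intro x hx; exact (hd x hx).hasDerivWithinAt
    · rw [interior_Icc]; intro x hx; exact (hd2 x hx).hasDerivWithinAt
    · rw [interior_Icc]; intro x hx
      have : (1-x)^(q-1-1) ≤ x^(q-1-1) :=
        Real.rpow_le_rpow_of_nonpos hx.1 (by linarith [hx.2]) (by linarith)
      exact mul_nonpos_of_nonneg_of_nonpos h0.le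
        (mul_nonpos_of_nonpos_of_nonneg (by linarith) (by linarith))
  have := hc.2 (show (0:ℝ) ∈ _ by norm_num) (show (1/2:ℝ) ∈ _ by norm_num)
    (show 0 ≤ 1 - 2*s by linarith) (show 0 ≤ 2*s by linarith) (by ring)
  norm_num [Real.zero_rpow h0.ne'] at this
  have e : 2 * s * (1/2) = s := by ring
  norm_num [e] at this
  linarith

lemma aux2 (q : ℝ) (h0 : 0 < q) (h1 : q < 1) (a b : ℝ) (hb : 0 < b) (hab : b ≤ a) :
    a^q - b^q ≤ (a+b)^(q-1) * (a-b) := by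
  have ha : 0 < a := by linarith
  have hc : 0 < a + b := by linarith
  have := aux1 q h0 h1 (b/(a+b)) (by positivity) (by rw [div_le_div_iff₀] <;> linarith)
  have e : 1 - b/(a+b) = a/(a+b) := by field_simp; ring
  rw [e, Real.div_rpow ha.le hc.le, Real.div_rpow hb.le hc.le] at this
  rw [Real.rpow_sub_one hc.ne']
  have hcq : 0 < (a+b)^q := by positivity
  have h2 := mul_le_mul_of_nonneg_left this hcq.le
  have e1 : (a+b)^q * (a^q/(a+b)^q - a/(a+b)) = a^q - (a+b)^q * a / (a+b) := by field_simp
  have e2 : (a+b)^q * (b^q/(a+b)^q - b/(a+b)) = b^q - (a+b)^q * b / (a+b) := by field_simp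
  rw [e1, e2] at h2
  have e3 : (a + b) ^ q / (a + b) * (a - b) = (a+b)^q * a / (a+b) - (a+b)^q * b / (a+b) := by
    field_simp
  linarith

lemma aux3 (q : ℝ) (h0 : 0 < q) (h1 : q < 1) (t : ℝ) (ht : 0 ≤ t) :
    2^q - 2 ≤ (Real.exp t + Real.exp (-t))^q - (Real.exp t)^q - (Real.exp (-t))^q := by
  have hd : ∀ t : ℝ, HasDerivAt (fun t => (Real.exp t + Real.exp (-t))^q - (Real.exp t)^q - (Real.exp (-t))^q)
     (q * ((Real.exp t + Real.exp (-t))^(q-1) * (Real.exp t - Real.exp (-t)) -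
       ((Real.exp t)^q - (Real.exp (-t))^q))) t := by
    intro t
    have e1 := Real.hasDerivAt_exp t
    have e2 : HasDerivAt (fun t => Real.exp (-t)) (-Real.exp (-t)) t := by
      simpa using (hasDerivAt_neg t).exp
    have e3 := (e1.add e2).rpow_const (p := q) (Or.inl (by simp; positivity))
    have e4 := e1.rpow_const (p := q) (Or.inl (by positivity))
    have e5 := e2.rpow_const (p := q) (Or.inl (by positivity))
    refine HasDerivAt.congr_deriv ((e3.sub e4).sub e5) ?_
    rw [Real.rpow_sub_one (Real.exp_pos t).ne', Real.rpow_sub_one (Real.exp_pos (-t)).ne']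
    have := (Real.exp_pos t).ne'
    have := (Real.exp_pos (-t)).ne'
    simp only [Pi.add_apply]
    field_simp
    ring
  have hm : MonotoneOn (fun t => (Real.exp t + Real.exp (-t))^q - (Real.exp t)^q - (Real.exp (-t))^q) (Set.Ici 0) := by
    refine monotoneOn_of_hasDerivWithinAt_nonneg (convex_Ici 0)
      (fun x _ => (hd x).continuousAt.continuousWithinAt) (fun x _ => (hd x).hasDerivWithinAt) ?_
    intro x hx
    rw [interior_Ici] at hx
    have hx : 0 < x := hx
    have := aux2 q h0 h1 (Real.exp x) (Real.exp (-x)) (Real.exp_pos _)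
      (Real.exp_le_exp.2 (by linarith))
    exact mul_nonneg h0.le (by linarith)
  have := hm (Set.mem_Ici.2 le_rfl) (Set.mem_Ici.2 ht) ht
  norm_num at this
  rw [show (2:ℝ)^q - 2 = 2^q - 1 - 1 by ring]
  simpa using this

lemma aux4 (q : ℝ) (h0 : 0 < q) (h1 : q < 1) (x y : ℝ) (hx : 0 < x) (hy : 0 < y) :
    x^q + y^q - (2 - 2^q) * (x*y)^(q/2) ≤ (x+y)^q := by
  wlog h : y ≤ x generalizing x y
  · have := this y x hy hx (by linarith)
    rw [mul_comm y x, add_comm y x] at this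
    linarith
  have ht : 0 ≤ Real.log (x/y) / 2 :=
    div_nonneg (Real.log_nonneg (by rwa [le_div_iff₀ hy, one_mul])) (by norm_num)
  have := aux3 q h0 h1 _ ht
  have e1 : Real.exp (Real.log (x/y) / 2) * Real.sqrt (x*y) = x := by
    rw [← Real.exp_log (show 0 < Real.sqrt (x*y) by positivity), ← Real.exp_add,
      Real.log_sqrt (by positivity), Real.log_div hx.ne' hy.ne', Real.log_mul hx.ne' hy.ne']
    ring_nf
    rw [Real.exp_log hx]
  have e2 : Real.exp (-(Real.log (x/y) / 2)) * Real.sqrt (x*y) = y := by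
    rw [← Real.exp_log (show 0 < Real.sqrt (x*y) by positivity), ← Real.exp_add,
      Real.log_sqrt (by positivity), Real.log_div hx.ne' hy.ne', Real.log_mul hx.ne' hy.ne']
    ring_nf
    rw [Real.exp_log hy]
  generalize Real.exp (Real.log (x/y) / 2) = a at *
  have hs : (x*y)^(q/2) = (Real.sqrt (x*y))^q := by
    rw [Real.sqrt_eq_rpow, ← Real.rpow_mul (by positivity)]; ring_nf
  rw [hs]
  have hp : 0 < Real.sqrt (x*y) := by positivity
  generalize Real.exp (-(Real.log (x/y) / 2)) = b at *
  generalize Real.sqrt (x*y) = r at *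
  have ha : 0 < a := by by_contra hh; nlinarith
  have hb : 0 < b := by by_contra hh; nlinarith
  rw [← e1, ← e2, ← add_mul, Real.mul_rpow (by positivity) hp.le, Real.mul_rpow (by positivity) hp.le, Real.mul_rpow (by positivity) hp.le]
  have hr : 0 < r^q := by positivity
  nlinarith [mul_le_mul_of_nonneg_right this hr.le]

/-- scalar inequality -/
lemma aux5 (p : ℝ) (hp : 1 < p) (a b : ℝ) (ha : 0 ≤ a) (hb : 0 ≤ b) :
    2^(1-1/p) * ((a+b)/2) + (1 - 2^(1-1/p)) * (a^(1/2:ℝ)*b^(1/2:ℝ)) ≤ (a^p/2+b^p/2)^(1/p) := by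
  have hp0 : 0 < p := by linarith
  have hc : (2:ℝ)^(1-1/p) * 2^(1/p) = 2 := by rw [← Real.rpow_add (by norm_num)]; simp
  have h2 : 0 < (2:ℝ)^(1/p) := by positivity
  have e0 : a^p/2+b^p/2 = (a^p+b^p)/2 := by ring
  have hap : (a^p)^(1/p) = a := by rw [← Real.rpow_mul ha]; field_simp; simp
  have hbp : (b^p)^(1/p) = b := by rw [← Real.rpow_mul hb]; field_simp; simp
  rw [e0, Real.div_rpow (by positivity) (by norm_num), le_div_iff₀ h2]
  have key : a + b - (2 - 2^(1/p)) * (a^(1/2:ℝ)*b^(1/2:ℝ)) ≤ (a^p+b^p)^(1/p) := by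
    rcases ha.eq_or_lt with rfl | ha'
    · rw [Real.zero_rpow hp0.ne', zero_add, zero_add]; rw [hbp]; norm_num
    rcases hb.eq_or_lt with rfl | hb'
    · rw [Real.zero_rpow hp0.ne', add_zero, add_zero]; rw [hap]; norm_num
    have := aux4 (1/p) (by positivity) (by rw [div_lt_one hp0]; exact hp) (a^p) (b^p) (by positivity) (by positivity)
    rw [hap, hbp, ← Real.mul_rpow ha hb, ← Real.rpow_mul (by positivity)] at this
    rw [← Real.mul_rpow ha hb]
    convert this using 4
    field_simp
  linear_combination key + ((a+b)/2 - a^(1/2:ℝ)*b^(1/2:ℝ)) * hc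

section helpers
open Matrix

noncomputable def dg {n : ℕ} (f : Fin n → ℝ) : Matrix (Fin n) (Fin n) ℂ := diagonal (fun i => (f i : ℂ))

lemma tr2 {n : ℕ} (U V : Matrix (Fin n) (Fin n) ℂ) (f g : Fin n → ℝ) :
    (U * dg f * Uᴴ * (V * dg g * Vᴴ)).trace =
      ((∑ i, ∑ j, Complex.normSq ((Uᴴ * V) i j) * (f i * g j) : ℝ) : ℂ) := by
  have : (U * dg f * Uᴴ * (V * dg g * Vᴴ)).trace = (dg f * (Uᴴ * V) * dg g * (Uᴴ * V)ᴴ).trace := by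
    rw [conjTranspose_mul, conjTranspose_conjTranspose]
    simp only [Matrix.mul_assoc]
    rw [trace_mul_comm]
    simp only [Matrix.mul_assoc]
  rw [this]
  simp only [trace, diag, dg]
  push_cast
  refine Finset.sum_congr rfl fun i _ => ?_
  rw [Matrix.mul_apply]
  refine Finset.sum_congr rfl fun j _ => ?_
  rw [mul_diagonal, diagonal_mul, conjTranspose_apply, Complex.normSq_eq_conj_mul_self]
  simp
  ring

lemma sq_tr {n : ℕ} (N : Matrix (Fin n) (Fin n) ℂ) (f g : Fin n → ℝ) :
    (dg f * N * dg g * Nᴴ).trace = ((∑ i, ∑ j, Complex.normSq (N i j) * (f i * g j) : ℝ) : ℂ) := by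
  simpa [Matrix.mul_assoc] using tr2 1 N f g

lemma tr1 {n : ℕ} (U : Matrix (Fin n) (Fin n) ℂ) (hU : Uᴴ * U = 1) (f : Fin n → ℝ) :
    (U * dg f * Uᴴ).trace = ((∑ i, f i : ℝ) : ℂ) := by
  rw [trace_mul_comm, ← Matrix.mul_assoc, hU, Matrix.one_mul]
  simp [dg, trace]

lemma dg_mul {n : ℕ} (f g : Fin n → ℝ) : dg f * dg g = dg (fun i => f i * g i) := by
  simp [dg]

lemma dg_one {n : ℕ} : dg (fun _ : Fin n => (1:ℝ)) = 1 := by simp [dg]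

lemma dg_conj_mul {n : ℕ} (U : Matrix (Fin n) (Fin n) ℂ) (hU : Uᴴ * U = 1) (f g : Fin n → ℝ) :
    (U * dg f * Uᴴ) * (U * dg g * Uᴴ) = U * dg (fun i => f i * g i) * Uᴴ := by
  rw [← dg_mul]
  calc _ = U * dg f * (Uᴴ * U) * dg g * Uᴴ := by simp only [Matrix.mul_assoc]
    _ = _ := by rw [hU]; simp only [Matrix.mul_assoc, Matrix.one_mul]

lemma dg_herm {n : ℕ} (f : Fin n → ℝ) : (dg f)ᴴ = dg f := by
  simp only [dg, diagonal_conjTranspose]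
  congr 1; ext i; simp

lemma pt (m k : ℂ) (l : ℝ) (hl : 0 < l) :
    2 * (k * (starRingEnd ℂ) m).re - l * Complex.normSq k ≤ Complex.normSq m * l⁻¹ := by
  rw [← div_eq_mul_inv, le_div_iff₀ hl]
  simp only [Complex.mul_re, Complex.conj_re, Complex.conj_im, Complex.normSq_apply]
  nlinarith [sq_nonneg (m.re - l * k.re), sq_nonneg (m.im - l * k.im)]

lemma resolvent_ineq {n : ℕ} (U V W : Matrix (Fin n) (Fin n) ℂ) (hU : Uᴴ * U = 1) (hV : Vᴴ * V = 1)
    (hW : Wᴴ * W = 1) (x y z : Fin n → ℝ) (hx : ∀ i, 0 ≤ x i) (hy : ∀ i, 0 ≤ y i)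
    (hz : ∀ i, 0 ≤ z i) (h : W * dg z * Wᴴ = U * dg x * Uᴴ + V * dg y * Vᴴ)
    (t : ℝ) (ht : 0 < t) :
    ∑ k, (t + z k)⁻¹ ≤ ∑ i, ∑ j, Complex.normSq ((Uᴴ * V) i j) * (t + (x i + y j))⁻¹ := by
  have hU' : U * Uᴴ = 1 := mul_eq_one_comm.1 hU
  have hV' : V * Vᴴ = 1 := mul_eq_one_comm.1 hV
  set d : Fin n → ℝ := fun k => (t + z k)⁻¹ with hd
  set K := W * dg d * Wᴴ with hK
  have hKh : Kᴴ = K := by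
    simp only [hK, conjTranspose_mul, conjTranspose_conjTranspose, dg_herm, Matrix.mul_assoc]
  set M := Uᴴ * V with hM
  set N := Uᴴ * K * V with hN
  have hNh : Nᴴ = Vᴴ * K * U := by
    simp only [hN, conjTranspose_mul, conjTranspose_conjTranspose, hKh, Matrix.mul_assoc]
  -- sum 1
  have s1 : ∑ i, ∑ j, (N i j * (starRingEnd ℂ) (M i j)).re = ∑ k, d k := by
    have : (N * Mᴴ).trace = ((∑ k, d k : ℝ) : ℂ) := by
      rw [← tr1 W hW, ← hK, hN, hM, conjTranspose_mul, conjTranspose_conjTranspose]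
      calc _ = (Uᴴ * (K * (V * Vᴴ) * U)).trace := by simp only [Matrix.mul_assoc]
        _ = _ := by rw [hV', trace_mul_comm, Matrix.mul_one, Matrix.mul_assoc, hU', Matrix.mul_one]
    rw [← Complex.ofReal_re (∑ k, d k), ← this]
    simp [trace, Matrix.mul_apply, Complex.re_sum]
  have s2 : ∑ i, ∑ j, (t + (x i + y j)) * Complex.normSq (N i j) = ∑ k, d k := by
    have e1 := sq_tr N x (fun _ => 1)
    have e2 := sq_tr N (fun _ => 1) y
    have e3 := sq_tr N (fun _ => 1) (fun _ => 1)
    rw [dg_one, Matrix.mul_one] at e1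
    rw [dg_one, Matrix.one_mul] at e2
    rw [dg_one, Matrix.mul_one, Matrix.one_mul] at e3
    have f1 : (dg x * N * Nᴴ).trace = (K * (U * dg x * Uᴴ) * K).trace := by
      rw [hNh, hN]
      calc _ = (dg x * (Uᴴ * K * (V * Vᴴ) * K * U)).trace := by simp only [Matrix.mul_assoc]
        _ = ((dg x * Uᴴ * K) * (K * U)).trace := by
            rw [hV']; simp only [Matrix.mul_assoc, Matrix.one_mul]
        _ = _ := by rw [trace_mul_comm]; simp only [Matrix.mul_assoc]
    have f2 : (N * dg y * Nᴴ).trace = (K * (V * dg y * Vᴴ) * K).trace := by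
      rw [hNh, hN]
      calc _ = (Uᴴ * (K * V * dg y * Vᴴ * K * U)).trace := by simp only [Matrix.mul_assoc]
        _ = (K * V * dg y * Vᴴ * K * (U * Uᴴ)).trace := by
            rw [trace_mul_comm]; simp only [Matrix.mul_assoc]
        _ = _ := by rw [hU']; simp only [Matrix.mul_assoc, Matrix.mul_one]
    have f3 : (N * Nᴴ).trace = (K * K).trace := by
      rw [hNh, hN]
      calc _ = (Uᴴ * (K * (V * Vᴴ) * K * U)).trace := by simp only [Matrix.mul_assoc]
        _ = (K * K * (U * Uᴴ)).trace := by
            rw [hV', trace_mul_comm]; simp only [Matrix.mul_assoc, Matrix.one_mul]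
        _ = _ := by rw [hU']; simp only [Matrix.mul_one]
    rw [f1] at e1
    rw [f2] at e2
    rw [f3, hK, dg_conj_mul W hW, tr1 W hW] at e3
    have e4 : (K * (U * dg x * Uᴴ) * K).trace + (K * (V * dg y * Vᴴ) * K).trace =
        ((∑ k, d k * z k * d k : ℝ) : ℂ) := by
      rw [← trace_add, ← Matrix.add_mul, ← Matrix.mul_add, ← h, hK, dg_conj_mul W hW, dg_conj_mul W hW,
        tr1 W hW]
    rw [e1, e2] at e4
    simp only [mul_one] at e3
    norm_cast at e3 e4
    have : ∑ i, ∑ j, (t + (x i + y j)) * Complex.normSq (N i j) =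
        t * (∑ i, ∑ j, Complex.normSq (N i j)) +
        ((∑ i, ∑ j, Complex.normSq (N i j) * (x i * 1)) + ∑ i, ∑ j, Complex.normSq (N i j) * (1 * y j)) := by
      simp only [Finset.mul_sum, ← Finset.sum_add_distrib]
      refine Finset.sum_congr rfl fun i _ => Finset.sum_congr rfl fun j _ => ?_
      ring
    rw [this, e4, ← e3, Finset.mul_sum, ← Finset.sum_add_distrib]
    refine Finset.sum_congr rfl fun k _ => ?_
    have : t + z k ≠ 0 := by have := hz k; positivity
    simp only [hd]
    field_simp
  have s3 : ∑ i, ∑ j, (2 * (N i j * (starRingEnd ℂ) (M i j)).re - (t + (x i + y j)) * Complex.normSq (N i j))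
      ≤ ∑ i, ∑ j, Complex.normSq (M i j) * (t + (x i + y j))⁻¹ :=
    Finset.sum_le_sum fun i _ => Finset.sum_le_sum fun j _ =>
      pt _ _ _ (by have := hx i; have := hy j; positivity)
  simp only [Finset.sum_sub_distrib, ← Finset.mul_sum] at s3
  rw [s1, s2] at s3
  linarith

lemma wsum {n : ℕ} (U V : Matrix (Fin n) (Fin n) ℂ) (hU : Uᴴ * U = 1) (hV : Vᴴ * V = 1) :
    ∑ i, ∑ j, Complex.normSq ((Uᴴ * V) i j) = n := by
  have := tr2 U V (fun _ => 1) (fun _ => 1)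
  simp only [dg_one, Matrix.mul_one, mul_eq_one_comm.1 hU, mul_eq_one_comm.1 hV] at this
  rw [trace_one, Fintype.card_fin] at this
  simp only [mul_one] at this
  exact_mod_cast this.symm

lemma keyineq {n : ℕ} (q : ℝ) (hq : q ∈ Set.Ioo (0:ℝ) 1) (U V W : Matrix (Fin n) (Fin n) ℂ)
    (hU : Uᴴ * U = 1) (hV : Vᴴ * V = 1)
    (hW : Wᴴ * W = 1) (x y z : Fin n → ℝ) (hx : ∀ i, 0 ≤ x i) (hy : ∀ i, 0 ≤ y i)
    (hz : ∀ i, 0 ≤ z i) (h : W * dg z * Wᴴ = U * dg x * Uᴴ + V * dg y * Vᴴ) :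
    ∑ i, ∑ j, Complex.normSq ((Uᴴ * V) i j) * (x i + y j)^q ≤ ∑ k, (z k)^q := by
  have hxy : ∀ i j, 0 ≤ x i + y j := fun i j => add_nonneg (hx i) (hy j)
  set c := ∫ t in Set.Ioi 0, Real.rpowIntegrand₀₁ q t 1 with hc
  have hc0 : 0 < c := Real.integral_rpowIntegrand₀₁_one_pos hq
  have I := fun (a : ℝ) (ha : 0 ≤ a) => Real.integrableOn_rpowIntegrand₀₁_Ioi (p := q) hq ha
  have E := fun (a : ℝ) (ha : 0 ≤ a) => Real.integral_rpowIntegrand₀₁_eq_rpow_mul_const (p := q) hq ha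
  have h1 : ∫ t in Set.Ioi (0:ℝ), (∑ k, Real.rpowIntegrand₀₁ q t (z k)) = (∑ k, (z k)^q) * c := by
    rw [MeasureTheory.integral_finsetSum _ (fun k _ => I _ (hz k)), Finset.sum_mul]
    exact Finset.sum_congr rfl fun k _ => E _ (hz k)
  have h2 : ∫ t in Set.Ioi (0:ℝ), (∑ i, ∑ j, Complex.normSq ((Uᴴ * V) i j) * Real.rpowIntegrand₀₁ q t (x i + y j))
      = (∑ i, ∑ j, Complex.normSq ((Uᴴ * V) i j) * (x i + y j)^q) * c := by
    rw [MeasureTheory.integral_finsetSum _ (fun i _ => MeasureTheory.integrable_finsetSum _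
      fun j _ => (I _ (hxy i j)).const_mul _), Finset.sum_mul]
    refine Finset.sum_congr rfl fun i _ => ?_
    rw [MeasureTheory.integral_finsetSum _ (fun j _ => (I _ (hxy i j)).const_mul _), Finset.sum_mul]
    refine Finset.sum_congr rfl fun j _ => ?_
    rw [MeasureTheory.integral_const_mul, E _ (hxy i j), mul_assoc]
  refine le_of_mul_le_mul_right ?_ hc0
  rw [← h1, ← h2]
  refine MeasureTheory.setIntegral_mono_on ?_ ?_ measurableSet_Ioi ?_
  · exact MeasureTheory.integrable_finsetSum _ fun i _ => MeasureTheory.integrable_finsetSum _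
      fun j _ => (I _ (hxy i j)).const_mul _
  · exact MeasureTheory.integrable_finsetSum _ fun k _ => I _ (hz k)
  intro t ht
  have ht : 0 < t := ht
  have r := resolvent_ineq U V W hU hV hW x y z hx hy hz h t ht
  have w := wsum U V hU hV
  have e1 : ∑ i, ∑ j, Complex.normSq ((Uᴴ * V) i j) * Real.rpowIntegrand₀₁ q t (x i + y j) =
      t^q * (t⁻¹ * (∑ i, ∑ j, Complex.normSq ((Uᴴ * V) i j)) -
        ∑ i, ∑ j, Complex.normSq ((Uᴴ * V) i j) * (t + (x i + y j))⁻¹) := by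
    simp only [Finset.mul_sum, ← Finset.sum_sub_distrib, Real.rpowIntegrand₀₁]
    refine Finset.sum_congr rfl fun i _ => Finset.sum_congr rfl fun j _ => ?_
    ring
  have e2 : ∑ k, Real.rpowIntegrand₀₁ q t (z k) = t^q * (t⁻¹ * n - ∑ k, (t + z k)⁻¹) := by
    simp only [Real.rpowIntegrand₀₁]
    rw [← Finset.mul_sum, Finset.sum_sub_distrib]
    simp [mul_comm]
  rw [e1, e2, w]
  have : 0 ≤ t^q := by positivity
  exact mul_le_mul_of_nonneg_left (by linarith) this

lemma spec {n : ℕ} (A : Matrix (Fin n) (Fin n) ℂ) (hA : A.PosSemidef) :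
    ∃ (U : Matrix (Fin n) (Fin n) ℂ) (a : Fin n → ℝ), Uᴴ * U = 1 ∧ (∀ i, 0 ≤ a i) ∧
      A = U * dg a * Uᴴ ∧ ∀ q : ℝ, matrixRpow A q = U * dg (fun i => a i ^ q) * Uᴴ := by
  refine ⟨hA.1.eigenvectorUnitary, hA.1.eigenvalues, ?_, hA.eigenvalues_nonneg, ?_, ?_⟩
  · exact Unitary.coe_star_mul_self hA.1.eigenvectorUnitary
  · conv_lhs => rw [hA.1.spectral_theorem]
    rw [Unitary.conjStarAlgAut_apply]
    rfl
  · intro q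
    rw [matrixRpow, hA.1.cfc_eq, Matrix.IsHermitian.cfc, Unitary.conjStarAlgAut_apply]
    rfl

lemma half {n : ℕ} (M : Matrix (Fin n) (Fin n) ℂ) : M / 2 = (1/2 : ℂ) • M := by
  have h2 : (2 : Matrix (Fin n) (Fin n) ℂ)⁻¹ = (1/2 : ℂ) • 1 := by
    apply Matrix.inv_eq_right_inv
    rw [Matrix.mul_smul, Matrix.mul_one]
    ext i j
    rw [Matrix.smul_apply]
    by_cases hij : i = j
    · subst hij
      simp [Matrix.ofNat_apply]
    · simp [Matrix.ofNat_apply, hij]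
  rw [div_eq_mul_inv, h2, Matrix.mul_smul, Matrix.mul_one]

lemma half_dg {n : ℕ} (U : Matrix (Fin n) (Fin n) ℂ) (f : Fin n → ℝ) :
    (1/2 : ℂ) • (U * dg f * Uᴴ) = U * dg (fun i => f i / 2) * Uᴴ := by
  have : dg (fun i => f i / 2) = (1/2 : ℂ) • dg f := by
    ext i j
    by_cases hij : i = j
    · subst hij; simp [dg]; ring
    · simp [dg, hij]
  rw [this, Matrix.mul_smul, Matrix.smul_mul]

lemma dg_psd {n : ℕ} (U : Matrix (Fin n) (Fin n) ℂ) (f : Fin n → ℝ) (hf : ∀ i, 0 ≤ f i) :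
    (U * dg f * Uᴴ).PosSemidef := by
  apply Matrix.PosSemidef.mul_mul_conjTranspose_same
  apply Matrix.PosSemidef.diagonal
  intro i
  simpa using hf i

end helpers

open scoped Matrix

/-- Corollary 4.2: the inequality for `p`-power means.  For positive semidefinite `A, B`
and `p ≥ 1`,
`Tr(((A^p + B^p)/2)^{1/p}) ≥ 2^{1-1/p}·Tr((A+B)/2) + (1 - 2^{1-1/p})·Tr(A^{1/2}·B^{1/2})`. -/
theorem trace_power_mean_inequality {n : ℕ}
    (A B : Matrix (Fin n) (Fin n) ℂ) (hA : A.PosSemidef) (hB : B.PosSemidef)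
    (p : ℝ) (hp : 1 ≤ p) :
    (matrixRpow ((matrixRpow A p + matrixRpow B p) / 2) (1 / p)).trace ≥
      ((2 ^ (1 - 1 / p) : ℝ) : ℂ) * ((A + B) / 2).trace +
        ((1 - 2 ^ (1 - 1 / p) : ℝ) : ℂ) * (matrixRpow A (1 / 2) * matrixRpow B (1 / 2)).trace := by
  obtain ⟨U, a, hU, ha, hAU, hAr⟩ := spec A hA
  obtain ⟨V, b, hV, hb, hBV, hBr⟩ := spec B hB
  have hU' : U * Uᴴ = 1 := mul_eq_one_comm.1 hU
  have hV' : V * Vᴴ = 1 := mul_eq_one_comm.1 hV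
  have hZe : (matrixRpow A p + matrixRpow B p) / 2 =
      U * dg (fun i => a i ^ p / 2) * Uᴴ + V * dg (fun i => b i ^ p / 2) * Vᴴ := by
    rw [half, smul_add, hAr, hBr, half_dg, half_dg]
  have hpa : ∀ i, 0 ≤ a i ^ p / 2 := fun i => by have := ha i; positivity
  have hpb : ∀ i, 0 ≤ b i ^ p / 2 := fun i => by have := hb i; positivity
  have hZ : ((matrixRpow A p + matrixRpow B p) / 2).PosSemidef := by
    rw [hZe]; exact (dg_psd U _ hpa).add (dg_psd V _ hpb)
  obtain ⟨W, z, hW, hz, hZW, hZr⟩ := spec _ hZ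
  have trA : A.trace = ((∑ i, ∑ j, Complex.normSq ((Uᴴ * V) i j) * (a i * 1) : ℝ) : ℂ) := by
    rw [← tr2 U V a (fun _ => 1), dg_one, Matrix.mul_one, hV', Matrix.mul_one, ← hAU]
  have trB : B.trace = ((∑ i, ∑ j, Complex.normSq ((Uᴴ * V) i j) * (1 * b j) : ℝ) : ℂ) := by
    rw [← tr2 U V (fun _ => 1) b, dg_one, Matrix.mul_one, hU', Matrix.one_mul, ← hBV]
  have hR : ((2 ^ (1 - 1 / p) : ℝ) : ℂ) * ((A + B) / 2).trace +
        ((1 - 2 ^ (1 - 1 / p) : ℝ) : ℂ) * (matrixRpow A (1 / 2) * matrixRpow B (1 / 2)).trace =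
      ((∑ i, ∑ j, Complex.normSq ((Uᴴ * V) i j) * (2^(1-1/p) * ((a i+b j)/2) +
        (1 - 2^(1-1/p)) * ((a i)^(1/2:ℝ)*(b j)^(1/2:ℝ))) : ℝ) : ℂ) := by
    rw [half, Matrix.trace_smul, Matrix.trace_add, trA, trB, hAr, hBr, tr2, smul_eq_mul,
      show (1/2:ℂ) = ((1/2:ℝ):ℂ) by push_cast; rfl]
    norm_cast
    simp only [Finset.mul_sum, ← Finset.sum_add_distrib]
    refine Finset.sum_congr rfl fun i _ => Finset.sum_congr rfl fun j _ => ?_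
    push_cast
    ring
  rw [hR, hZr, tr1 W hW, ge_iff_le, Complex.real_le_real]
  rcases hp.eq_or_lt with rfl | hp1
  · have e : ((∑ k, z k : ℝ) : ℂ) = (1/2 : ℂ) * (A.trace + B.trace) := by
      rw [← tr1 W hW, ← hZW, half, hAr, hBr]
      simp only [Real.rpow_one]
      rw [← hAU, ← hBV, Matrix.trace_smul, Matrix.trace_add, smul_eq_mul]
    rw [trA, trB, show (1/2:ℂ) = ((1/2:ℝ):ℂ) by push_cast; rfl] at e
    norm_cast at e
    simp only [div_one, sub_self, Real.rpow_zero, Real.rpow_one, one_mul, zero_mul, add_zero]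
    rw [e, ← Finset.sum_add_distrib, Finset.mul_sum]
    refine Finset.sum_le_sum fun i _ => ?_
    rw [← Finset.sum_add_distrib, Finset.mul_sum]
    refine Finset.sum_le_sum fun j _ => ?_
    push_cast
    linarith
  · have hp0 : 0 < p := by linarith
    refine le_trans ?_ (keyineq (1/p) ⟨by positivity, by rw [div_lt_one hp0]; exact hp1⟩ U V W
      hU hV hW _ _ z hpa hpb hz (hZW.symm.trans hZe))
    exact Finset.sum_le_sum fun i _ => Finset.sum_le_sum fun j _ =>
      mul_le_mul_of_nonneg_left (aux5 p hp1 (a i) (b j) (ha i) (hb j)) (Complex.normSq_nonneg _)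
end

section
/- Let A and B be positive semidefinite n×n complex matrices and let q be a real number with 0 < q ≤ 1 or 2 ≤ q ≤ 3. Then Tr((A+B)^q) - Tr(A^q) - Tr(B^q) ≥ (2^q - 2)·Tr((A^{1/2}·B·A^{1/2})^{q/2}). -/
open ComplexOrder

open Matrix in
lemma aux_quad {n : ℕ} {H : Matrix (Fin n) (Fin n) ℂ} (hH : H.IsHermitian) (a : Fin n → ℂ) :
    star ((hH.eigenvectorUnitary : Matrix (Fin n) (Fin n) ℂ) *ᵥ a) ⬝ᵥ
      (H *ᵥ ((hH.eigenvectorUnitary : Matrix (Fin n) (Fin n) ℂ) *ᵥ a)) =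
      ((∑ j, hH.eigenvalues j * ‖a j‖ ^ 2 : ℝ) : ℂ) := by
  have h1 := hH.conjStarAlgAut_star_eigenvectorUnitary
  rw [Unitary.conjStarAlgAut_star_apply] at h1
  rw [star_mulVec, ← dotProduct_mulVec, mulVec_mulVec, mulVec_mulVec, ← star_eq_conjTranspose]
  rw [h1]
  simp only [dotProduct, mulVec_diagonal, Pi.star_apply, Function.comp_apply]
  push_cast
  refine Finset.sum_congr rfl fun j _ => ?_
  have := Complex.conj_mul' (a j)
  rw [← this]
  simp only [RCLike.star_def, Complex.coe_algebraMap]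
  ring

open Matrix in
lemma aux_norm {n : ℕ} {U : Matrix (Fin n) (Fin n) ℂ} (hU : star U * U = 1) (a : Fin n → ℂ) :
    star (U *ᵥ a) ⬝ᵥ (U *ᵥ a) = ((∑ j, ‖a j‖ ^ 2 : ℝ) : ℂ) := by
  rw [star_mulVec, ← dotProduct_mulVec, mulVec_mulVec, ← star_eq_conjTranspose, hU, one_mulVec]
  simp [dotProduct, Complex.conj_mul']

open Matrix in
lemma aux_exists {n : ℕ} (p q : Fin n → Prop) (hpq : ∀ j, q j → p j) (i : Fin n) (hi : p i)
    (hi' : ¬ q i) (K : Matrix (Fin n) (Fin n) ℂ) :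
    ∃ a : Fin n → ℂ, a ≠ 0 ∧ (∀ j, ¬ p j → a j = 0) ∧ ∀ j, q j → (K *ᵥ a) j = 0 := by
  classical
  let ext : ({j // p j} → ℂ) →ₗ[ℂ] (Fin n → ℂ) :=
    Function.ExtendByZero.linearMap ℂ Subtype.val
  let res : (Fin n → ℂ) →ₗ[ℂ] ({j // q j} → ℂ) :=
    LinearMap.funLeft ℂ ℂ Subtype.val
  have := LinearMap.ker_ne_bot_of_finrank_lt (f := res ∘ₗ (Matrix.mulVecLin K) ∘ₗ ext) (by
    simp only [Module.finrank_fintype_fun_eq_card]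
    apply Fintype.card_lt_of_injective_of_notMem (fun j => ⟨j.1, hpq _ j.2⟩) (b := ⟨i, hi⟩)
    · rintro ⟨x, hx⟩
      have hx' : x.1 = i := congrArg Subtype.val hx
      exact hi' (hx' ▸ x.2)
    · intro x y hxy
      have := congrArg Subtype.val hxy
      exact Subtype.ext this)
  obtain ⟨c, hc, hc0⟩ := (Submodule.ne_bot_iff _).1 this
  have hext : ∀ j, ext c j.1 = c j := fun j => by
    simp only [ext, Function.ExtendByZero.linearMap_apply]
    exact Subtype.val_injective.extend_apply _ _ _
  refine ⟨ext c, ?_, ?_, ?_⟩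
  · intro h0
    apply hc0
    ext j
    rw [← hext j, h0]; rfl
  · intro j hj
    simp only [ext, Function.ExtendByZero.linearMap_apply]
    rw [Function.extend_apply']
    · rfl
    · rintro ⟨x, rfl⟩; exact hj x.2
  · intro j hj
    have := congrFun (LinearMap.mem_ker.1 hc) ⟨j, hj⟩
    simpa [res, LinearMap.funLeft_apply] using this

open Matrix in
lemma aux_minmax {n : ℕ} {M N T : Matrix (Fin n) (Fin n) ℂ} (hM : M.IsHermitian)
    (hN : N.IsHermitian) (hT : IsUnit T) (i : Fin n) (τ : ℝ)
    (h : ∀ x : Fin n → ℂ, (hN.eigenvalues i) * (star x ⬝ᵥ x).re ≤ (star x ⬝ᵥ (N *ᵥ x)).re →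
      τ * (star (T *ᵥ x) ⬝ᵥ (T *ᵥ x)).re ≤ (star (T *ᵥ x) ⬝ᵥ (M *ᵥ (T *ᵥ x))).re) :
    τ ≤ hM.eigenvalues i := by
  set e : Fin (Fintype.card (Fin n)) ≃ Fin n := Fintype.equivOfCardEq (Fintype.card_fin _) with he
  have aN : ∀ j k, e.symm j ≤ e.symm k → hN.eigenvalues k ≤ hN.eigenvalues j := 
    fun j k hjk => hN.eigenvalues₀_antitone hjk
  have aM : ∀ j k, e.symm j ≤ e.symm k → hM.eigenvalues k ≤ hM.eigenvalues j := 
    fun j k hjk => hM.eigenvalues₀_antitone hjk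
  set UN : Matrix (Fin n) (Fin n) ℂ := (hN.eigenvectorUnitary : Matrix (Fin n) (Fin n) ℂ)
  set UM : Matrix (Fin n) (Fin n) ℂ := (hM.eigenvectorUnitary : Matrix (Fin n) (Fin n) ℂ)
  have uN : star UN * UN = 1 := Unitary.coe_star_mul_self _
  have uM : star UM * UM = 1 := Unitary.coe_star_mul_self _
  have uM' : UM * star UM = 1 := Unitary.coe_mul_star_self _
  have qN := aux_quad hN
  have qM := aux_quad hM
  change ∀ a, star (UN *ᵥ a) ⬝ᵥ (N *ᵥ (UN *ᵥ a)) = _ at qN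
  change ∀ a, star (UM *ᵥ a) ⬝ᵥ (M *ᵥ (UM *ᵥ a)) = _ at qM
  clear_value UN UM e
  obtain ⟨a, ha0, ha1, ha2⟩ : ∃ a : Fin n → ℂ, a ≠ 0 ∧ (∀ j, ¬ e.symm j ≤ e.symm i → a j = 0) ∧
      ∀ j, e.symm j < e.symm i → ((star UM * T * UN) *ᵥ a) j = 0 := by
    exact aux_exists (fun j => e.symm j ≤ e.symm i) (fun j => e.symm j < e.symm i) (fun j h => h.le) i le_rfl (lt_irrefl _) _
  set b := (star UM * T * UN) *ᵥ a with hb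
  have hTb : T *ᵥ (UN *ᵥ a) = UM *ᵥ b := by
    rw [hb, mulVec_mulVec, mulVec_mulVec, ← mul_assoc, ← mul_assoc, uM', one_mul]
  have hb0 : b ≠ 0 := by
    intro h0
    apply ha0
    have h1 : T *ᵥ (UN *ᵥ a) = 0 := by rw [hTb, h0, mulVec_zero]
    have h2 : UN *ᵥ a = 0 := by
      apply (Matrix.mulVec_injective_iff_isUnit.2 hT)
      rw [h1, mulVec_zero]
    have := congrArg (fun v => star UN *ᵥ v) h2
    simpa [mulVec_mulVec, uN] using this
  have := h (UN *ᵥ a) (by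
    rw [aux_norm uN, qN, Complex.ofReal_re, Complex.ofReal_re, Finset.mul_sum]
    apply Finset.sum_le_sum
    intro j _
    by_cases hj : e.symm j ≤ e.symm i
    · exact mul_le_mul_of_nonneg_right (aN _ _ hj) (by positivity)
    · simp [ha1 j hj])
  rw [hTb, aux_norm uM, qM, Complex.ofReal_re, Complex.ofReal_re] at this
  have h3 : ∑ j, hM.eigenvalues j * ‖b j‖ ^ 2 ≤ hM.eigenvalues i * ∑ j, ‖b j‖ ^ 2 := by
    rw [Finset.mul_sum]
    apply Finset.sum_le_sum
    intro j _
    by_cases hj : e.symm j < e.symm i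
    · simp [ha2 j hj]
    · exact mul_le_mul_of_nonneg_right (aM _ _ (not_lt.1 hj)) (by positivity)
  have h4 : 0 < ∑ j, ‖b j‖ ^ 2 := by
    obtain ⟨j, hj⟩ := Function.ne_iff.1 hb0
    apply Finset.sum_pos' (fun _ _ => by positivity) ⟨j, Finset.mem_univ _, ?_⟩
    have : 0 < ‖b j‖ := norm_pos_iff.2 hj
    positivity
  exact le_of_mul_le_mul_right (this.trans h3) h4


open Matrix in
lemma aux_det {n : ℕ} {H : Matrix (Fin n) (Fin n) ℂ} (hH : H.IsHermitian) (u : ℝ) :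
    (1 + u • H).det = ((∏ j, (1 + u * hH.eigenvalues j) : ℝ) : ℂ) := by
  have h1 := hH.conjStarAlgAut_star_eigenvectorUnitary
  rw [Unitary.conjStarAlgAut_star_apply] at h1
  have u1 : star (hH.eigenvectorUnitary : Matrix (Fin n) (Fin n) ℂ) * (hH.eigenvectorUnitary : Matrix (Fin n) (Fin n) ℂ) = 1 := Unitary.coe_star_mul_self _
  have h2 : star (hH.eigenvectorUnitary : Matrix (Fin n) (Fin n) ℂ) * (1 + u • H) * (hH.eigenvectorUnitary : Matrix (Fin n) (Fin n) ℂ) = diagonal (fun j => ((1 + u * hH.eigenvalues j : ℝ) : ℂ)) := by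
    rw [mul_add, add_mul, mul_one, u1, mul_smul_comm, smul_mul_assoc, h1]
    ext a b
    by_cases hab : a = b
    · subst hab; simp
    · simp [hab]
  have h3 := congrArg det h2
  rw [det_mul, det_mul, mul_right_comm, ← det_mul, u1, det_one, one_mul, det_diagonal] at h3
  rw [h3]; push_cast; rfl

open Matrix MatrixOrder in
lemma aux_core {n : ℕ} {R B M : Matrix (Fin n) (Fin n) ℂ} (hR : R.IsHermitian)
    (hB : B.PosSemidef) (hM : M.IsHermitian) (κ : ℝ) (hκ : 0 < κ) (h : R * B * R = κ • M) :
    ∃ ν : Fin n → ℝ, (∀ i, 0 ≤ ν i ∧ ν i < 1 ∧ ν i ≤ (1 - √(ν i)) ^ 2 * (κ * hM.eigenvalues i)) ∧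
      (1 + R * R + B).det = (1 + R * R).det * (1 + B).det * ((∏ i, (1 - ν i) : ℝ) : ℂ) := by
  have hX : (1 + B).PosDef := PosDef.one.add_posSemidef hB
  have hXu : IsUnit (1 + B).det := (isUnit_iff_isUnit_det _).1 hX.isUnit
  set G := (1 + B)⁻¹ with hG
  have hGX : G * (1 + B) = 1 := nonsing_inv_mul _ hXu
  have hXG : (1 + B) * G = 1 := mul_nonsing_inv _ hXu
  have hGp : G.PosDef := hX.inv
  have hRR : (R * R).PosSemidef := by
    have := posSemidef_conjTranspose_mul_self R
    rwa [hR.eq] at this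
  have hY : (1 + R * R).PosDef := PosDef.one.add_posSemidef hRR
  obtain ⟨S, hS⟩ := CStarAlgebra.nonneg_iff_eq_star_mul_self.mp hY.posSemidef.nonneg
  rw [star_eq_conjTranspose] at hS
  have hSu : IsUnit S.det := by
    have h1 := (isUnit_iff_isUnit_det _).1 hY.isUnit
    rw [hS, det_mul] at h1
    exact isUnit_of_mul_isUnit_right h1
  set T := S⁻¹ with hT
  have hST : S * T = 1 := mul_nonsing_inv _ hSu
  have hTS : T * S = 1 := nonsing_inv_mul _ hSu
  have hTu : IsUnit T := IsUnit.of_mul_eq_one _ hTS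
  have hTT : Tᴴ * (1 + R * R) * T = 1 := by
    rw [hS, ← mul_assoc, ← conjTranspose_mul, hST, conjTranspose_one, one_mul, hST]
  have hQ : (1 - G).PosSemidef := by
    have h1 := hB.conjTranspose_mul_mul_same G
    have h2 := hGp.isHermitian.eq
    have h3 := (hGp.posSemidef.conjTranspose_mul_mul_same B)
    have h4 : B = (1 + B) - 1 := by simp
    have h5 : 1 - G = Gᴴ * B * G + Bᴴ * G * B - Bᴴ * G * B  + (1 - G - Gᴴ * B * G) := by abel
    have h6 : G * B = 1 - G := by
      rw [eq_sub_iff_add_eq, ← hGX]; noncomm_ring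
    have h7 : B * G = 1 - G := by
      rw [eq_sub_iff_add_eq, ← hXG]; noncomm_ring
    have h8 : G * B * G + G * B * (G * B) = 1 - G := by
      rw [h6]; noncomm_ring
    have h9 : (G * B * (G * B)) = (G * B) * (G * B)ᴴ := by
      rw [conjTranspose_mul, h2, hB.isHermitian.eq, h6, h7]
    rw [← h8, h9]
    rw [h2] at h1
    exact h1.add (posSemidef_self_mul_conjTranspose _)
  have hRQR : (R * (1 - G) * R).PosSemidef := by
    have := hQ.conjTranspose_mul_mul_same R
    rwa [hR.eq] at this
  have hRGR : (R * G * R).PosSemidef := by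
    have := hGp.posSemidef.conjTranspose_mul_mul_same R
    rwa [hR.eq] at this
  set N := Tᴴ * (R * (1 - G) * R) * T with hN
  have hNp : N.PosSemidef := hRQR.conjTranspose_mul_mul_same T
  have hN1 : 1 + (-1 : ℝ) • N = Tᴴ * (1 + R * G * R) * T := by
    rw [hN]
    nth_rw 1 [← hTT]
    simp only [neg_smul, one_smul]; noncomm_ring
  have hdet : (1 + R * G * R).det * (1 + B).det = (1 + R * R + B).det := by
    rw [det_one_add_mul_comm]
    have h2 : (1 + R * (R * G)) = (1 + B + R * R) * G := by
      rw [add_mul, hXG, mul_assoc]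
    rw [h2, ← det_mul, mul_assoc, hGX, mul_one]
    congr 1; abel
  have hdetN := aux_det hNp.isHermitian (-1)
  have hlt : ∀ i, hNp.isHermitian.eigenvalues i < 1 := by
    intro i
    have hp : (Tᴴ * (1 + R * G * R) * T).PosDef := by
      have h1 : (1 + R * G * R).PosDef := PosDef.one.add_posSemidef hRGR
      have h2 := h1.posSemidef.conjTranspose_mul_mul_same T
      rw [h2.posDef_iff_isUnit]
      have h3 : IsUnit Tᴴ := hTu.star
      exact (h3.mul h1.isUnit).mul hTu
    rw [← hN1] at hp
    have hq := aux_quad hNp.isHermitian (Pi.single i 1)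
    have hn := aux_norm (Unitary.coe_star_mul_self hNp.isHermitian.eigenvectorUnitary) (Pi.single i 1)
    set x := (hNp.isHermitian.eigenvectorUnitary : Matrix (Fin n) (Fin n) ℂ) *ᵥ (Pi.single i 1)
    have hs : ∑ j, ‖(Pi.single i 1 : Fin n → ℂ) j‖ ^ 2 = 1 := by
      rw [Finset.sum_eq_single i] <;> simp +contextual
    have hs' : ∑ j, hNp.isHermitian.eigenvalues j * ‖(Pi.single i 1 : Fin n → ℂ) j‖ ^ 2 = hNp.isHermitian.eigenvalues i := by
      rw [Finset.sum_eq_single i] <;> simp +contextual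
    rw [hs] at hn
    rw [hs'] at hq
    have hx : x ≠ 0 := by
      intro h0; rw [h0] at hn; simp at hn
    have := hp.dotProduct_mulVec_pos hx
    rw [add_mulVec, one_mulVec, dotProduct_add, neg_one_smul, neg_mulVec, dotProduct_neg, hn, hq] at this
    have h5 := (Complex.lt_def.1 this).1
    simp at h5
    exact h5
  refine ⟨hNp.isHermitian.eigenvalues, fun i => ⟨hNp.eigenvalues_nonneg i, hlt i, ?_⟩, ?_⟩
  · have hν0 := hNp.eigenvalues_nonneg i
    have hν1 := hlt i
    set ν := hNp.isHermitian.eigenvalues i with hν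
    set σ := √ν with hσ
    have hσ2 : σ ^ 2 = ν := Real.sq_sqrt hν0
    have hσ0 : 0 ≤ σ := Real.sqrt_nonneg _
    have hσ1 : σ < 1 := by nlinarith
    have hpos : 0 < (1 - σ) ^ 2 * κ := by
      have : 0 < 1 - σ := by linarith
      positivity
    have hZ : ((1 - σ) ^ 2 • B - (1 - G) + ν • (1 : Matrix (Fin n) (Fin n) ℂ)).PosSemidef := by
      have h1 := hGp.posSemidef.conjTranspose_mul_mul_same ((1 - σ) • (1 + B) - 1)
      have h2 : ((1 - σ) • (1 + B) - 1)ᴴ = ((1 - σ) • (1 + B) - 1) := by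
        rw [conjTranspose_sub, conjTranspose_smul, hX.isHermitian.eq]; simp
      rw [h2] at h1
      convert h1 using 1
      have h3 : ((1 - σ) • (1 + B) - 1) * G = (1 - σ) • 1 - G := by
        rw [sub_mul, smul_mul_assoc, hXG, one_mul]
      rw [h3, mul_sub, sub_mul, mul_one, smul_mul_assoc, one_mul, mul_smul_comm, hGX, ← hσ2]
      module
    have hW := hZ.conjTranspose_mul_mul_same R
    rw [hR.eq] at hW
    have hW2 : R * ((1 - σ) ^ 2 • B - (1 - G) + ν • (1 : Matrix (Fin n) (Fin n) ℂ)) * R =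
        ((1 - σ) ^ 2 * κ) • M - R * (1 - G) * R + ν • (R * R) := by
      rw [mul_add, mul_sub, add_mul, sub_mul, mul_smul_comm, mul_smul_comm, smul_mul_assoc, h,
        smul_mul_assoc, smul_smul, mul_one]
    rw [hW2] at hW
    have := aux_minmax hM hNp.isHermitian hTu i (ν / ((1 - σ) ^ 2 * κ)) (by
      intro x hx
      have h1 := hW.dotProduct_mulVec_nonneg (T *ᵥ x)
      have h2 := (Complex.le_def.1 h1).1
      rw [add_mulVec, sub_mulVec, smul_mulVec, smul_mulVec, dotProduct_add, dotProduct_sub,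
        dotProduct_smul, dotProduct_smul] at h2
      have h3 : star (T *ᵥ x) ⬝ᵥ ((R * (1 - G) * R) *ᵥ (T *ᵥ x)) = star x ⬝ᵥ (N *ᵥ x) := by
        rw [star_mulVec, ← dotProduct_mulVec, mulVec_mulVec, mulVec_mulVec, hN, ← mul_assoc]
      have h4 : star (T *ᵥ x) ⬝ᵥ (T *ᵥ x) + star (T *ᵥ x) ⬝ᵥ ((R * R) *ᵥ (T *ᵥ x)) = star x ⬝ᵥ x := by
        have : star x ⬝ᵥ x = star x ⬝ᵥ (1 *ᵥ x) := by rw [one_mulVec]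
        rw [this, ← hTT, ← dotProduct_add]
        have : T *ᵥ x + (R * R) *ᵥ (T *ᵥ x) = (1 + R * R) *ᵥ (T *ᵥ x) := by
          rw [add_mulVec, one_mulVec]
        rw [this, star_mulVec, ← dotProduct_mulVec, mulVec_mulVec, mulVec_mulVec]
      rw [h3] at h2
      have h5 := congrArg Complex.re h4
      simp only [Complex.add_re, Complex.sub_re, Complex.zero_re, Complex.real_smul, Complex.re_ofReal_mul] at h2 h5
      rw [div_mul_eq_mul_div, div_le_iff₀ hpos]
      rw [← h5] at hx
      nlinarith)
    rw [div_le_iff₀ hpos] at this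
    linarith
  · rw [← hdet]
    have h1 : (∏ i, (1 - hNp.isHermitian.eigenvalues i) : ℝ) = ∏ i, (1 + (-1) * hNp.isHermitian.eigenvalues i) := by
      congr 1; ext i; ring
    have h2 := congrArg det hTT
    rw [h1, ← hdetN, hN1]
    simp only [det_mul, det_one] at h2 ⊢
    linear_combination (-(1 + R * G * R).det * (1 + B).det) * h2

open MeasureTheory Set Filter in
lemma aux_scale (g : ℝ → ℝ) (q : ℝ) (hq : 0 < q) (h0 : g 0 = 0)
    (hg : IntegrableOn (fun u => g u * u ^ (-q - 1)) (Ioi 0)) (x : ℝ) (hx : 0 ≤ x) :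
    IntegrableOn (fun u => g (u * x) * u ^ (-q - 1)) (Ioi 0) ∧
    ∫ u in Ioi (0 : ℝ), g (u * x) * u ^ (-q - 1) = x ^ q * ∫ u in Ioi (0 : ℝ), g u * u ^ (-q - 1) := by
  rcases hx.eq_or_lt with rfl | hx
  · simp [h0, Real.zero_rpow hq.ne']
  have he : EqOn (fun u => g (u * x) * u ^ (-q - 1))
      (fun u => x ^ (q + 1) * (fun v => g v * v ^ (-q - 1)) (u * x)) (Ioi 0) := by
    intro u hu
    have hu : 0 < u := hu
    simp only
    rw [Real.mul_rpow hu.le hx.le]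
    have : x ^ (q + 1) * x ^ (-q - 1) = 1 := by
      rw [← Real.rpow_add hx]; ring_nf; simp
    linear_combination (- g (u * x) * u ^ (-q - 1)) * this
  constructor
  · refine IntegrableOn.congr_fun ?_ he.symm measurableSet_Ioi
    apply Integrable.const_mul
    have := (integrableOn_Ioi_comp_mul_right_iff (fun v => g v * v ^ (-q - 1)) 0 hx).2 (by simpa using hg)
    exact this
  · rw [setIntegral_congr_fun measurableSet_Ioi he, integral_const_mul,
      integral_comp_mul_right_Ioi (fun v => g v * v ^ (-q - 1)) 0 hx, zero_mul, smul_eq_mul,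
      Real.rpow_add hx]
    field_simp
    rw [Real.rpow_one]

open MeasureTheory Set Filter in
lemma aux_intble (g : ℝ → ℝ) (q s₁ s₂ C₁ C₂ : ℝ) (h1 : q < s₁) (h2 : s₂ < q)
    (hc : ContinuousOn g (Ioi 0)) (hpos : ∀ u, 0 < u → 0 < g u)
    (hb1 : ∀ u, 0 < u → u ≤ 1 → g u ≤ C₁ * u ^ s₁) (hb2 : ∀ u, 1 ≤ u → g u ≤ C₂ * u ^ s₂) :
    IntegrableOn (fun u => g u * u ^ (-q - 1)) (Ioi 0) ∧
    0 < ∫ u in Ioi (0 : ℝ), g u * u ^ (-q - 1) := by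
  have hc' : ContinuousOn (fun u : ℝ => g u * u ^ (-q - 1)) (Ioi 0) :=
    hc.mul (continuousOn_id.rpow_const fun x hx => Or.inl (ne_of_gt hx))
  have hpos' : ∀ u ∈ Ioi (0 : ℝ), 0 < g u * u ^ (-q - 1) := fun u hu =>
    mul_pos (hpos u hu) (Real.rpow_pos_of_pos hu _)
  have hint : IntegrableOn (fun u => g u * u ^ (-q - 1)) (Ioi 0) := by
    rw [← Ioc_union_Ioi_eq_Ioi (zero_le_one (α := ℝ))]
    refine IntegrableOn.union ?_ ?_
    · have hi : IntegrableOn (fun u : ℝ => C₁ * u ^ (s₁ - q - 1)) (Ioc 0 1) := by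
        apply Integrable.const_mul
        have := intervalIntegral.intervalIntegrable_rpow' (a := 0) (b := 1) (r := s₁ - q - 1) (by linarith)
        exact (intervalIntegrable_iff_integrableOn_Ioc_of_le zero_le_one).1 this
      refine Integrable.mono' hi ((hc'.mono Ioc_subset_Ioi_self).aestronglyMeasurable measurableSet_Ioc) ?_
      refine (ae_restrict_iff' measurableSet_Ioc).2 (Eventually.of_forall fun u hu => ?_)
      rw [Real.norm_of_nonneg (hpos' u hu.1).le]
      have := mul_le_mul_of_nonneg_right (hb1 u hu.1 hu.2) (Real.rpow_pos_of_pos hu.1 (-q - 1)).le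
      rw [mul_assoc, ← Real.rpow_add hu.1, show s₁ + (-q - 1) = s₁ - q - 1 by ring] at this
      exact this
    · have hi : IntegrableOn (fun u : ℝ => C₂ * u ^ (s₂ - q - 1)) (Ioi 1) := by
        apply Integrable.const_mul
        exact integrableOn_Ioi_rpow_of_lt (by linarith) one_pos
      refine Integrable.mono' hi ((hc'.mono (Ioi_subset_Ioi zero_le_one)).aestronglyMeasurable measurableSet_Ioi) ?_
      refine (ae_restrict_iff' measurableSet_Ioi).2 (Eventually.of_forall fun u hu => ?_)
      have hu0 : 0 < u := lt_trans one_pos hu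
      rw [Real.norm_of_nonneg (hpos' u hu0).le]
      have := mul_le_mul_of_nonneg_right (hb2 u (le_of_lt hu)) (Real.rpow_pos_of_pos hu0 (-q - 1)).le
      rw [mul_assoc, ← Real.rpow_add hu0, show s₂ + (-q - 1) = s₂ - q - 1 by ring] at this
      exact this
  refine ⟨hint, ?_⟩
  rw [setIntegral_pos_iff_support_of_nonneg_ae _ hint]
  · have : Ioi (0 : ℝ) ⊆ Function.support (fun u => g u * u ^ (-q - 1)) := fun u hu => (hpos' u hu).ne'
    rw [inter_eq_self_of_subset_right this]
    simp
  · exact (ae_restrict_iff' measurableSet_Ioi).2 (Eventually.of_forall fun u hu => (hpos' u hu).le)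

open MeasureTheory Set Filter in
lemma aux_sum {n : ℕ} (g : ℝ → ℝ) (q : ℝ) (hq : 0 < q) (h0 : g 0 = 0)
    (hg : IntegrableOn (fun u => g u * u ^ (-q - 1)) (Ioi 0) ∧
      0 < ∫ u in Ioi (0 : ℝ), g u * u ^ (-q - 1))
    (α β γ c : Fin n → ℝ) (hα : ∀ i, 0 ≤ α i) (hβ : ∀ i, 0 ≤ β i) (hγ : ∀ i, 0 ≤ γ i)
    (hc : ∀ i, 0 ≤ c i)
    (h : ∀ u, 0 < u → ∑ i, (g (u * α i) + g (u * β i) - g (u * γ i)) ≤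
      ∑ i, (2 * g (u * c i) - g (u * (2 * c i)))) :
    ∑ i, (α i ^ q + β i ^ q - γ i ^ q) ≤ ∑ i, (2 * c i ^ q - (2 * c i) ^ q) := by
  have S := aux_scale g q hq h0 hg.1
  set I := ∫ u in Ioi (0 : ℝ), g u * u ^ (-q - 1)
  have i1 : ∀ i, Integrable (fun u => g (u * α i) * u ^ (-q - 1) + g (u * β i) * u ^ (-q - 1) - g (u * γ i) * u ^ (-q - 1)) (volume.restrict (Ioi 0)) :=
    fun i => ((S _ (hα i)).1.add (S _ (hβ i)).1).sub (S _ (hγ i)).1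
  have h2c : ∀ i, 0 ≤ 2 * c i := fun i => by have := hc i; positivity
  have i2 : ∀ i, Integrable (fun u => 2 * (g (u * c i) * u ^ (-q - 1)) - g (u * (2 * c i)) * u ^ (-q - 1)) (volume.restrict (Ioi 0)) :=
    fun i => ((S _ (hc i)).1.const_mul 2).sub (S _ (h2c i)).1
  have key : ∫ u in Ioi (0 : ℝ), ∑ i, (g (u * α i) * u ^ (-q - 1) + g (u * β i) * u ^ (-q - 1) - g (u * γ i) * u ^ (-q - 1)) ≤
      ∫ u in Ioi (0 : ℝ), ∑ i, (2 * (g (u * c i) * u ^ (-q - 1)) - g (u * (2 * c i)) * u ^ (-q - 1)) := by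
    refine setIntegral_mono_on (integrable_finsetSum _ fun i _ => i1 i) (integrable_finsetSum _ fun i _ => i2 i) measurableSet_Ioi ?_
    intro u hu
    have := mul_le_mul_of_nonneg_right (h u hu) (Real.rpow_pos_of_pos hu (-q - 1)).le
    rw [Finset.sum_mul, Finset.sum_mul] at this
    convert this using 2 <;> ring
  rw [integral_finsetSum _ fun i _ => i1 i, integral_finsetSum _ fun i _ => i2 i] at key
  have e1 : ∀ i, ∫ u in Ioi (0 : ℝ), (g (u * α i) * u ^ (-q - 1) + g (u * β i) * u ^ (-q - 1) - g (u * γ i) * u ^ (-q - 1)) = (α i ^ q + β i ^ q - γ i ^ q) * I := by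
    intro i
    have hab : Integrable (fun u => g (u * α i) * u ^ (-q - 1) + g (u * β i) * u ^ (-q - 1))
      (volume.restrict (Ioi 0)) := (S _ (hα i)).1.add (S _ (hβ i)).1
    rw [integral_sub hab (S _ (hγ i)).1, integral_add (S _ (hα i)).1 (S _ (hβ i)).1,
      (S _ (hα i)).2, (S _ (hβ i)).2, (S _ (hγ i)).2]
    ring
  have e2 : ∀ i, ∫ u in Ioi (0 : ℝ), (2 * (g (u * c i) * u ^ (-q - 1)) - g (u * (2 * c i)) * u ^ (-q - 1)) = (2 * c i ^ q - (2 * c i) ^ q) * I := by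
    intro i
    rw [integral_sub ((S _ (hc i)).1.const_mul 2) (S _ (h2c i)).1, integral_const_mul,
      (S _ (hc i)).2, (S _ (h2c i)).2]
    ring
  simp only [e1, e2, ← Finset.sum_mul] at key
  exact le_of_mul_le_mul_right key hg.2

lemma aux_log_up (x : ℝ) (hx : 0 ≤ x) : Real.log (1 + x) ≤ x - x ^ 2 / 2 + x ^ 3 / 3 := by
  have hd : ∀ y : ℝ, 0 ≤ y → HasDerivAt (fun y : ℝ => y - y ^ 2 / 2 + y ^ 3 / 3 - Real.log (1 + y)) (y ^ 3 / (1 + y)) y := by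
    intro y hy
    have h1 : (1 + y) ≠ 0 := by positivity
    have := (((hasDerivAt_id y).sub ((hasDerivAt_pow 2 y).div_const 2)).add ((hasDerivAt_pow 3 y).div_const 3)).sub
      (((hasDerivAt_id y).const_add 1).log h1)
    refine HasDerivAt.congr_deriv this ?_
    norm_num
    field_simp
    ring
  have hm : MonotoneOn (fun y : ℝ => y - y ^ 2 / 2 + y ^ 3 / 3 - Real.log (1 + y)) (Set.Ici 0) := by
    apply monotoneOn_of_deriv_nonneg (convex_Ici 0)
    · exact fun y hy => (hd y hy).continuousAt.continuousWithinAt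
    · intro y hy
      rw [interior_Ici] at hy
      exact (hd y (le_of_lt hy)).differentiableAt.differentiableWithinAt
    · intro y hy
      rw [interior_Ici] at hy
      have hy : 0 < y := hy
      rw [(hd y hy.le).deriv]; positivity
  have := hm (Set.mem_Ici.2 le_rfl) (Set.mem_Ici.2 hx) hx
  simp at this
  linarith

open MeasureTheory Set in
lemma aux_g1 (q : ℝ) (h0 : 0 < q) (h1 : q < 1) :
    IntegrableOn (fun u => Real.log (1 + u) * u ^ (-q - 1)) (Ioi 0) ∧
    0 < ∫ u in Ioi (0 : ℝ), Real.log (1 + u) * u ^ (-q - 1) := by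
  refine aux_intble (fun u => Real.log (1 + u)) q 1 (q / 2) 1 (2 ^ (q / 2) / (q / 2)) h1 (by linarith) ?_ ?_ ?_ ?_
  · refine ContinuousOn.log (by fun_prop) fun x hx => ?_
    have : (0 : ℝ) < x := hx
    positivity
  · intro u hu; exact Real.log_pos (by linarith)
  · intro u hu _
    have := Real.log_le_sub_one_of_pos (x := 1 + u) (by linarith)
    simp; linarith
  · intro u hu
    have h2 := Real.log_le_rpow_div (x := 1 + u) (ε := q / 2) (by linarith) (by linarith)
    refine h2.trans ?_
    rw [div_mul_eq_mul_div, ← Real.mul_rpow (by norm_num) (by linarith)]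
    gcongr
    linarith

open MeasureTheory Set in
lemma aux_g2 (q : ℝ) (h0 : 2 < q) (h1 : q < 3) :
    IntegrableOn (fun u => (Real.log (1 + u) - u + u ^ 2 / 2) * u ^ (-q - 1)) (Ioi 0) ∧
    0 < ∫ u in Ioi (0 : ℝ), (Real.log (1 + u) - u + u ^ 2 / 2) * u ^ (-q - 1) := by
  refine aux_intble (fun u => Real.log (1 + u) - u + u ^ 2 / 2) q 3 2 (1 / 3) (1 / 2) h1 h0 ?_ ?_ ?_ ?_
  · refine ((ContinuousOn.log (by fun_prop) fun x hx => ?_).sub (by fun_prop)).add (by fun_prop)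
    have : (0 : ℝ) < x := hx
    positivity
  · intro u hu
    have h2 := Real.le_log_one_add_of_nonneg hu.le
    have h3 : 0 < 2 * u / (u + 2) - u + u ^ 2 / 2 := by
      have : 2 * u / (u + 2) - u + u ^ 2 / 2 = u ^ 3 / (2 * (u + 2)) := by
        field_simp; ring
      rw [this]; positivity
    linarith
  · intro u hu _
    have := aux_log_up u hu.le
    have h3 : u ^ (3 : ℝ) = u ^ 3 := by exact_mod_cast Real.rpow_natCast u 3
    rw [h3]; linarith
  · intro u hu
    have := Real.log_le_sub_one_of_pos (x := 1 + u) (by linarith)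
    have h3 : u ^ (2 : ℝ) = u ^ 2 := by exact_mod_cast Real.rpow_natCast u 2
    rw [h3]; linarith

open Matrix in
lemma aux_loginq {n : ℕ} {A R B M : Matrix (Fin n) (Fin n) ℂ} (hR : R.IsHermitian)
    (hA : A.PosSemidef) (hB : B.PosSemidef) (hC : (A + B).PosSemidef) (hM : M.PosSemidef)
    (hRR : R * R = A) (h : R * B * R = M) (u : ℝ) (hu : 0 < u) :
    ∑ i, (Real.log (1 + u * hA.isHermitian.eigenvalues i)
      + Real.log (1 + u * hB.isHermitian.eigenvalues i)
      - Real.log (1 + u * hC.isHermitian.eigenvalues i)) ≤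
    ∑ i, (2 * Real.log (1 + u * √(hM.isHermitian.eigenvalues i))
      - Real.log (1 + u * (2 * √(hM.isHermitian.eigenvalues i)))) := by
  have hsu : √u * √u = u := Real.mul_self_sqrt hu.le
  have hR' : (√u • R).IsHermitian := by
    unfold Matrix.IsHermitian
    rw [conjTranspose_smul, hR.eq]; simp
  obtain ⟨ν, hν, hdet⟩ := aux_core hR' (hB.smul hu.le) hM.isHermitian (u ^ 2) (by positivity) (by
    rw [smul_mul_assoc, smul_mul_assoc, mul_smul_comm, mul_smul_comm, smul_mul_assoc, smul_smul,
      smul_smul, h]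
    congr 1
    linear_combination u * hsu)
  have h2 : √u • R * √u • R = u • A := by
    rw [smul_mul_assoc, mul_smul_comm, smul_smul, hsu, hRR]
  rw [h2, add_assoc, ← smul_add, aux_det hA.isHermitian, aux_det hB.isHermitian,
    aux_det hC.isHermitian] at hdet
  have hdet' := Complex.ofReal_injective (hdet.trans (by push_cast; rfl :
    _ = (((∏ j, (1 + u * hA.isHermitian.eigenvalues j)) * (∏ j, (1 + u * hB.isHermitian.eigenvalues j))
      * ∏ i, (1 - ν i) : ℝ) : ℂ)))
  have pA : ∀ i, 0 < 1 + u * hA.isHermitian.eigenvalues i := fun i => by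
    have := hA.eigenvalues_nonneg i; positivity
  have pB : ∀ i, 0 < 1 + u * hB.isHermitian.eigenvalues i := fun i => by
    have := hB.eigenvalues_nonneg i; positivity
  have pC : ∀ i, 0 < 1 + u * hC.isHermitian.eigenvalues i := fun i => by
    have := hC.eigenvalues_nonneg i; positivity
  have pν : ∀ i, 0 < 1 - ν i := fun i => by linarith [(hν i).2.1]
  have hl := congrArg Real.log hdet'
  rw [Real.log_mul (mul_pos (Finset.prod_pos fun i _ => pA i) (Finset.prod_pos fun i _ => pB i)).ne'
      (Finset.prod_pos fun i _ => pν i).ne',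
    Real.log_mul (Finset.prod_pos fun i _ => pA i).ne' (Finset.prod_pos fun i _ => pB i).ne',
    Real.log_prod fun i _ => (pA i).ne', Real.log_prod fun i _ => (pB i).ne',
    Real.log_prod fun i _ => (pC i).ne', Real.log_prod fun i _ => (pν i).ne'] at hl
  have hν2 : ∀ i, - Real.log (1 - ν i) ≤ 2 * Real.log (1 + u * √(hM.isHermitian.eigenvalues i))
      - Real.log (1 + u * (2 * √(hM.isHermitian.eigenvalues i))) := by
    intro i
    obtain ⟨a1, a2, a3⟩ := hν i
    have hm := hM.eigenvalues_nonneg i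
    set c := √(hM.isHermitian.eigenvalues i)
    have hc0 : 0 ≤ c := Real.sqrt_nonneg _
    have hc2 : c ^ 2 = hM.isHermitian.eigenvalues i := Real.sq_sqrt hm
    set σ := √(ν i)
    have hσ0 : 0 ≤ σ := Real.sqrt_nonneg _
    have hσ2 : σ ^ 2 = ν i := Real.sq_sqrt a1
    have hσ1 : σ < 1 := by nlinarith
    have hs : σ ≤ (1 - σ) * (u * c) := by
      have h1 : 0 ≤ 1 - σ := by linarith
      have : 0 ≤ (1 - σ) * (u * c) := by positivity
      refine (sq_le_sq₀ hσ0 this).1 ?_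
      calc σ ^ 2 = ν i := hσ2
        _ ≤ _ := a3
        _ = _ := by rw [← hc2]; ring
    have hx : 0 ≤ u * c := by positivity
    set x := u * c with hxdef
    have hx2 : u * (2 * c) = 2 * x := by rw [hxdef]; ring
    rw [hx2]
    have h3 : (1 + 2 * x) ≤ (1 - ν i) * (1 + x) ^ 2 := by
      rw [← hσ2]
      have h4 : σ * (1 + x) ≤ x := by linarith
      have h5 : 0 ≤ σ * (1 + x) := by positivity
      nlinarith
    have h6 := Real.log_le_log (by positivity) h3
    rw [Real.log_mul (pν i).ne' (by positivity), Real.log_pow] at h6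
    push_cast at h6
    linarith
  have := Finset.sum_le_sum fun i (_ : i ∈ Finset.univ) => hν2 i
  refine le_trans (le_of_eq ?_) this
  rw [Finset.sum_sub_distrib, Finset.sum_add_distrib, hl, Finset.sum_neg_distrib]
  ring

lemma aux_trace {n : ℕ} {H : Matrix (Fin n) (Fin n) ℂ} (hH : H.IsHermitian) (f : ℝ → ℝ) :
    (cfc f H).trace = ((∑ i, f (hH.eigenvalues i) : ℝ) : ℂ) := by
  rw [hH.cfc_eq, Matrix.IsHermitian.cfc, Unitary.conjStarAlgAut_apply, Matrix.trace_mul_comm,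
    ← mul_assoc, Unitary.coe_star_mul_self, one_mul, Matrix.trace_diagonal]
  push_cast; rfl

lemma aux_sumsq {n : ℕ} {H : Matrix (Fin n) (Fin n) ℂ} (hH : H.IsHermitian) :
    (H * H).trace = ((∑ i, hH.eigenvalues i ^ 2 : ℝ) : ℂ) := by
  rw [← aux_trace hH (fun x => x ^ 2), cfc_pow_id H 2 hH.isSelfAdjoint, pow_two]

lemma aux_open {n : ℕ} {A R B M : Matrix (Fin n) (Fin n) ℂ} (hR : R.IsHermitian)
    (hA : A.PosSemidef) (hB : B.PosSemidef) (hC : (A + B).PosSemidef) (hM : M.PosSemidef)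
    (hRR : R * R = A) (h : R * B * R = M) (q : ℝ) (hq : (0 < q ∧ q < 1) ∨ (2 < q ∧ q < 3)) :
    ∑ i, (hA.isHermitian.eigenvalues i ^ q + hB.isHermitian.eigenvalues i ^ q
      - hC.isHermitian.eigenvalues i ^ q) ≤
    ∑ i, (2 * √(hM.isHermitian.eigenvalues i) ^ q - (2 * √(hM.isHermitian.eigenvalues i)) ^ q) := by
  have hlog := aux_loginq hR hA hB hC hM hRR h
  rcases hq with ⟨h0, h1⟩ | ⟨h0, h1⟩
  · exact aux_sum (fun u => Real.log (1 + u)) q h0 (by simp) (aux_g1 q h0 h1) _ _ _ _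
      hA.eigenvalues_nonneg hB.eigenvalues_nonneg hC.eigenvalues_nonneg
      (fun i => Real.sqrt_nonneg _) hlog
  · refine aux_sum (fun u => Real.log (1 + u) - u + u ^ 2 / 2) q (by linarith) (by simp)
      (aux_g2 q h0 h1) _ _ _ _
      hA.eigenvalues_nonneg hB.eigenvalues_nonneg hC.eigenvalues_nonneg
      (fun i => Real.sqrt_nonneg _) ?_
    intro u hu
    have hl := hlog u hu
    have t1 : ∑ i, hA.isHermitian.eigenvalues i + ∑ i, hB.isHermitian.eigenvalues i
        = ∑ i, hC.isHermitian.eigenvalues i := by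
      have := Matrix.trace_add A B
      rw [hA.isHermitian.trace_eq_sum_eigenvalues, hB.isHermitian.trace_eq_sum_eigenvalues,
        hC.isHermitian.trace_eq_sum_eigenvalues] at this
      exact_mod_cast this.symm
    have t2 : ∑ i, hC.isHermitian.eigenvalues i ^ 2 = ∑ i, hA.isHermitian.eigenvalues i ^ 2
        + ∑ i, hB.isHermitian.eigenvalues i ^ 2 + 2 * ∑ i, hM.isHermitian.eigenvalues i := by
      have eM : M.trace = ((∑ i, hM.isHermitian.eigenvalues i : ℝ) : ℂ) := by
        rw [hM.isHermitian.trace_eq_sum_eigenvalues]; push_cast; rfl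
      have e1 : ((A + B) * (A + B)).trace = (A * A).trace + (B * B).trace + 2 * M.trace := by
        have : M.trace = (A * B).trace := by
          rw [← h, Matrix.trace_mul_comm, ← mul_assoc, hRR]
        rw [this, add_mul, mul_add, mul_add]
        simp only [Matrix.trace_add]
        rw [Matrix.trace_mul_comm B A]; ring
      rw [aux_sumsq hA.isHermitian, aux_sumsq hB.isHermitian, aux_sumsq hC.isHermitian,
        eM] at e1
      exact_mod_cast e1
    have t3 : ∑ i, √(hM.isHermitian.eigenvalues i) ^ 2 = ∑ i, hM.isHermitian.eigenvalues i :=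
      Finset.sum_congr rfl fun i _ => Real.sq_sqrt (hM.eigenvalues_nonneg i)
    simp only [mul_add, mul_sub, mul_pow, mul_div_assoc', Finset.sum_add_distrib, Finset.sum_sub_distrib,
      ← Finset.mul_sum, ← Finset.sum_div] at hl ⊢
    rw [← t1, t2, t3]
    linarith

open Filter Topology in
lemma aux_closed {n : ℕ} {A R B M : Matrix (Fin n) (Fin n) ℂ} (hR : R.IsHermitian)
    (hA : A.PosSemidef) (hB : B.PosSemidef) (hC : (A + B).PosSemidef) (hM : M.PosSemidef)
    (hRR : R * R = A) (h : R * B * R = M) (q : ℝ) (hq : (0 < q ∧ q ≤ 1) ∨ (2 ≤ q ∧ q ≤ 3)) :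
    ∑ i, (hA.isHermitian.eigenvalues i ^ q + hB.isHermitian.eigenvalues i ^ q
      - hC.isHermitian.eigenvalues i ^ q) ≤
    ∑ i, (2 * √(hM.isHermitian.eigenvalues i) ^ q - (2 * √(hM.isHermitian.eigenvalues i)) ^ q) := by
  have ho := aux_open hR hA hB hC hM hRR h
  have hq0 : q ≠ 0 := by rcases hq with hq | hq <;> linarith [hq.1]
  have hcl : q ∈ closure {q : ℝ | (0 < q ∧ q < 1) ∨ (2 < q ∧ q < 3)} := by
    have : {q : ℝ | (0 < q ∧ q < 1) ∨ (2 < q ∧ q < 3)} = Set.Ioo 0 1 ∪ Set.Ioo 2 3 := rfl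
    rw [this, closure_union, closure_Ioo (by norm_num), closure_Ioo (by norm_num)]
    rcases hq with hq | hq
    · exact Or.inl ⟨hq.1.le, hq.2⟩
    · exact Or.inr hq
  have hr : ∀ x : ℝ, ContinuousAt (fun p : ℝ => x ^ p) q := fun x => Real.continuousAt_const_rpow' hq0
  have := mem_closure_iff_nhdsWithin_neBot.1 hcl
  refine le_of_tendsto_of_tendsto (b := 𝓝[{q : ℝ | (0 < q ∧ q < 1) ∨ (2 < q ∧ q < 3)}] q)
    (f := fun q => ∑ i, (hA.isHermitian.eigenvalues i ^ q + hB.isHermitian.eigenvalues i ^ q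
      - hC.isHermitian.eigenvalues i ^ q))
    (g := fun q => ∑ i, (2 * √(hM.isHermitian.eigenvalues i) ^ q - (2 * √(hM.isHermitian.eigenvalues i)) ^ q))
    ?_ ?_ ?_
  · refine tendsto_finsetSum _ fun i _ => ?_
    exact (((hr _).add (hr _)).sub (hr _)).tendsto.mono_left nhdsWithin_le_nhds
  · refine tendsto_finsetSum _ fun i _ => ?_
    exact (((hr _).const_mul 2).sub (hr _)).tendsto.mono_left nhdsWithin_le_nhds
  · filter_upwards [self_mem_nhdsWithin] with p hp using ho p hp

/-- Corollary 4.3, first part: for positive semidefinite `A, B` and `0 < q ≤ 1` or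
`2 ≤ q ≤ 3`,
`Tr((A+B)^q) - Tr(A^q) - Tr(B^q) ≥ (2^q - 2)·Tr((A^{1/2}·B·A^{1/2})^{q/2})`. -/
theorem trace_rpow_alt_inequality {n : ℕ}
    (A B : Matrix (Fin n) (Fin n) ℂ) (hA : A.PosSemidef) (hB : B.PosSemidef)
    (q : ℝ) (hq : (0 < q ∧ q ≤ 1) ∨ (2 ≤ q ∧ q ≤ 3)) :
    (matrixRpow (A + B) q).trace - (matrixRpow A q).trace - (matrixRpow B q).trace ≥
      ((2 ^ q - 2 : ℝ) : ℂ) *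
        (matrixRpow (matrixRpow A (1 / 2) * B * matrixRpow A (1 / 2)) (q / 2)).trace := by
  have hR : (matrixRpow A (1 / 2)).IsHermitian := cfc_predicate (R := ℝ) (p := IsSelfAdjoint) _ A
  have hcont : Continuous (fun x : ℝ => x ^ (1 / 2 : ℝ)) := Real.continuous_rpow_const (by norm_num)
  have hRR : matrixRpow A (1 / 2) * matrixRpow A (1 / 2) = A := by
    unfold matrixRpow
    rw [← cfc_mul (fun x : ℝ => x ^ (1 / 2 : ℝ)) (fun x : ℝ => x ^ (1 / 2 : ℝ)) A
      hcont.continuousOn hcont.continuousOn]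
    conv_rhs => rw [← cfc_id' ℝ A hA.isHermitian.isSelfAdjoint]
    apply cfc_congr
    intro x hx
    rw [hA.isHermitian.spectrum_real_eq_range_eigenvalues] at hx
    obtain ⟨i, rfl⟩ := hx
    have := hA.eigenvalues_nonneg i
    simp only
    rw [← Real.sqrt_eq_rpow, Real.mul_self_sqrt this]
  have hM : (matrixRpow A (1 / 2) * B * matrixRpow A (1 / 2)).PosSemidef := by
    have := hB.conjTranspose_mul_mul_same (matrixRpow A (1 / 2))
    rwa [hR.eq] at this
  have hC : (A + B).PosSemidef := hA.add hB
  have key := aux_closed hR hA hB hC hM hRR rfl q hq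
  generalize matrixRpow A (1 / 2) * B * matrixRpow A (1 / 2) = M at hM key
  unfold matrixRpow
  rw [aux_trace hA.isHermitian, aux_trace hB.isHermitian, aux_trace hC.isHermitian,
    aux_trace hM.isHermitian]
  have e1 : ∀ i, √(hM.isHermitian.eigenvalues i) ^ q = hM.isHermitian.eigenvalues i ^ (q / 2) := by
    intro i
    rw [Real.sqrt_eq_rpow, ← Real.rpow_mul (hM.eigenvalues_nonneg i)]
    congr 1; ring
  have e2 : ∀ i, (2 * √(hM.isHermitian.eigenvalues i)) ^ q =
      2 ^ q * hM.isHermitian.eigenvalues i ^ (q / 2) := by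
    intro i
    rw [Real.mul_rpow (by norm_num) (Real.sqrt_nonneg _), e1]
  simp only [e1, e2, Finset.sum_add_distrib, Finset.sum_sub_distrib, ← Finset.mul_sum] at key
  have : (2 ^ q - 2 : ℝ) * ∑ i, hM.isHermitian.eigenvalues i ^ (q / 2) ≤
    ∑ i, hC.isHermitian.eigenvalues i ^ q - ∑ i, hA.isHermitian.eigenvalues i ^ q
      - ∑ i, hB.isHermitian.eigenvalues i ^ q := by linarith
  rw [ge_iff_le, ← Complex.ofReal_sub, ← Complex.ofReal_sub, ← Complex.ofReal_mul]
  exact Complex.real_le_real.2 this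
end

section
/- Let A and B be n×n complex matrices and let q be a real number such that either (i) q ≤ -2 and A, B are positive definite, or (ii) 1 ≤ q ≤ 2 and A, B are positive semidefinite. Then Tr((A+B)^q) - Tr(A^q) - Tr(B^q) ≤ (2^q - 2)·Tr((A^{1/2}·B·A^{1/2})^{q/2}). -/
open ComplexOrder

namespace TraceAux
open Matrix
variable {n : ℕ}

/-- complex-valued spectral calculus -/
noncomputable def hc {A : Matrix (Fin n) (Fin n) ℂ} (hA : A.IsHermitian) (φ : ℝ → ℂ) :
    Matrix (Fin n) (Fin n) ℂ :=
  (hA.eigenvectorUnitary : Matrix (Fin n) (Fin n) ℂ) * diagonal (fun i => φ (hA.eigenvalues i)) *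
    (hA.eigenvectorUnitary : Matrix (Fin n) (Fin n) ℂ)ᴴ

section
variable {A : Matrix (Fin n) (Fin n) ℂ} (hA : A.IsHermitian)

lemma UsU : (hA.eigenvectorUnitary : Matrix (Fin n) (Fin n) ℂ)ᴴ * hA.eigenvectorUnitary = 1 := by
  simpa [star_eq_conjTranspose] using Unitary.coe_star_mul_self hA.eigenvectorUnitary

lemma UUs : (hA.eigenvectorUnitary : Matrix (Fin n) (Fin n) ℂ) *
    (hA.eigenvectorUnitary : Matrix (Fin n) (Fin n) ℂ)ᴴ = 1 := by
  simpa [star_eq_conjTranspose] using Unitary.coe_mul_star_self hA.eigenvectorUnitary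

lemma hc_mul (φ ψ : ℝ → ℂ) : hc hA φ * hc hA ψ = hc hA (fun x => φ x * ψ x) := by
  unfold hc
  have : ∀ U D E V : Matrix (Fin n) (Fin n) ℂ, V * U = 1 →
      (U * D * V) * (U * E * V) = U * (D * E) * V := by
    intro U D E V h
    calc (U * D * V) * (U * E * V) = U * D * (V * U) * E * V := by noncomm_ring
      _ = _ := by rw [h]; noncomm_ring
  rw [this _ _ _ _ (UsU hA), diagonal_mul_diagonal]

lemma hc_congr {φ ψ : ℝ → ℂ} (h : ∀ i, φ (hA.eigenvalues i) = ψ (hA.eigenvalues i)) :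
    hc hA φ = hc hA ψ := by
  unfold hc; simp only [h]

lemma hc_one : hc hA (fun _ => 1) = 1 := by
  unfold hc; simp [UUs]

lemma hc_star (φ : ℝ → ℂ) : (hc hA φ)ᴴ = hc hA (fun x => star (φ x)) := by
  unfold hc
  simp [conjTranspose_mul, diagonal_conjTranspose, mul_assoc]
  rfl

lemma hc_trace (φ : ℝ → ℂ) : (hc hA φ).trace = ∑ i, φ (hA.eigenvalues i) := by
  unfold hc
  rw [trace_mul_comm, ← mul_assoc, UsU, one_mul, trace_diagonal]

lemma cfc_eq_hc (f : ℝ → ℝ) : cfc f A = hc hA (fun x => (f x : ℂ)) := by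
  rw [hA.cfc_eq, Matrix.IsHermitian.cfc, Unitary.conjStarAlgAut_apply]
  rfl

lemma hc_id : hc hA (fun x => (x : ℂ)) = A := by
  rw [← cfc_eq_hc hA (fun x => x)]
  exact cfc_id' ℝ A hA.isSelfAdjoint

end

lemma unitary_row {X : Matrix (Fin n) (Fin n) ℂ} (h : X * Xᴴ = 1) (i : Fin n) :
    ∑ j, ‖X i j‖ ^ 2 = 1 := by
  have := congrFun (congrFun h i) i
  simp only [mul_apply, conjTranspose_apply, one_apply_eq, RCLike.star_def, Complex.mul_conj] at this
  have h2 : ((∑ j, ‖X i j‖ ^ 2 : ℝ) : ℂ) = 1 := by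
    rw [← this]; push_cast
    refine Finset.sum_congr rfl fun j _ => ?_
    rw [Complex.normSq_eq_norm_sq]; push_cast; rfl
  exact_mod_cast h2

lemma unitary_col {X : Matrix (Fin n) (Fin n) ℂ} (h : X * Xᴴ = 1) (j : Fin n) :
    ∑ i, ‖X i j‖ ^ 2 = 1 := by
  have h' : Xᴴ * Xᴴᴴ = 1 := by rw [conjTranspose_conjTranspose]; exact mul_eq_one_comm.mp h
  have := unitary_row h' j
  simpa [conjTranspose_apply] using this

lemma young_diag {X Y : Matrix (Fin n) (Fin n) ℂ} (hX : X * Xᴴ = 1) (hY : Y * Yᴴ = 1)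
    (f g α β : Fin n → ℝ) (h : ∀ i j, |f i * g j| ≤ α i + β j) :
    ‖(X * diagonal (fun i => (f i : ℂ)) * Y * diagonal (fun i => (g i : ℂ))).trace‖
      ≤ ∑ i, α i + ∑ j, β j := by
  have e : (X * diagonal (fun i => (f i : ℂ)) * Y * diagonal (fun i => (g i : ℂ))).trace
      = ∑ j, ∑ i, X j i * f i * Y i j * g j := by
    simp only [trace, diag_apply, mul_diagonal]
    refine Finset.sum_congr rfl fun j _ => ?_
    rw [mul_apply, Finset.sum_mul]
    simp only [mul_diagonal]
  rw [e]
  calc ‖∑ j, ∑ i, X j i * f i * Y i j * g j‖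
      ≤ ∑ j, ∑ i, (‖X j i‖ ^ 2 + ‖Y i j‖ ^ 2) / 2 * (α i + β j) := by
        refine (norm_sum_le _ _).trans (Finset.sum_le_sum fun j _ => ?_)
        refine (norm_sum_le _ _).trans (Finset.sum_le_sum fun i _ => ?_)
        have : ‖X j i * f i * Y i j * g j‖ = (‖X j i‖ * ‖Y i j‖) * |f i * g j| := by
          simp [abs_mul]; ring
        rw [this]
        refine mul_le_mul ?_ (h i j) (abs_nonneg _) (by positivity)
        nlinarith [sq_nonneg (‖X j i‖ - ‖Y i j‖)]
    _ = (∑ i, (∑ j, ‖X j i‖ ^ 2 + ∑ j, ‖Y i j‖ ^ 2) / 2 * α i) +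
        ∑ j, (∑ i, ‖X j i‖ ^ 2 + ∑ i, ‖Y i j‖ ^ 2) / 2 * β j := by
        simp only [mul_add, Finset.sum_add_distrib]
        congr 1
        · rw [Finset.sum_comm]
          simp only [← Finset.sum_add_distrib, ← Finset.sum_mul, ← Finset.sum_div]
        · simp only [← Finset.sum_add_distrib, ← Finset.sum_mul, ← Finset.sum_div]
    _ = _ := by
        simp only [unitary_row hX, unitary_col hX, unitary_row hY, unitary_col hY]
        norm_num

lemma unit_mul {X Y : Matrix (Fin n) (Fin n) ℂ} (hX : X * Xᴴ = 1) (hY : Y * Yᴴ = 1) :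
    (X * Y) * (X * Y)ᴴ = 1 := by
  rw [conjTranspose_mul, mul_assoc, ← mul_assoc Y, hY, one_mul, hX]

lemma unit_star {X : Matrix (Fin n) (Fin n) ℂ} (hX : X * Xᴴ = 1) : Xᴴ * Xᴴᴴ = 1 := by
  rw [conjTranspose_conjTranspose]; exact mul_eq_one_comm.mp hX

lemma young {A B X Y : Matrix (Fin n) (Fin n) ℂ} (hA : A.IsHermitian) (hB : B.IsHermitian)
    (hX : X * Xᴴ = 1) (hY : Y * Yᴴ = 1)
    (f g : ℝ → ℝ) (α β : Fin n → ℝ)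
    (h : ∀ i j, |f (hA.eigenvalues i) * g (hB.eigenvalues j)| ≤ α i + β j) :
    ‖(X * hc hA (fun x => (f x : ℂ)) * Y * hc hB (fun x => (g x : ℂ))).trace‖
      ≤ ∑ i, α i + ∑ j, β j := by
  set U := (hA.eigenvectorUnitary : Matrix (Fin n) (Fin n) ℂ) with hU
  set V := (hB.eigenvectorUnitary : Matrix (Fin n) (Fin n) ℂ) with hV
  have e := young_diag (X := Vᴴ * X * U) (Y := Uᴴ * Y * V)
    (unit_mul (unit_mul (unit_star (UUs hB)) hX) (UUs hA))
    (unit_mul (unit_mul (unit_star (UUs hA)) hY) (UUs hB)) _ _ α β h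
  convert e using 2
  unfold hc
  rw [← hU, ← hV]
  simp only [← mul_assoc]
  rw [trace_mul_comm]
  simp only [← mul_assoc]

/-- exponentials on the strip -/
def Good (g : ℂ → ℂ) : Prop :=
  Differentiable ℂ g ∧ ∃ C : ℝ, ∀ z : ℂ, 0 ≤ z.re → z.re ≤ 1 → ‖g z‖ ≤ C

lemma Good.const (c : ℂ) : Good (fun _ => c) := ⟨by fun_prop, ‖c‖, by simp⟩

lemma Good.mul {f g : ℂ → ℂ} (hf : Good f) (hg : Good g) : Good (fun z => f z * g z) := by
  obtain ⟨h1, C, hC⟩ := hf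
  obtain ⟨h2, D, hD⟩ := hg
  refine ⟨h1.mul h2, C * D, fun z h0 h1 => ?_⟩
  rw [norm_mul]
  exact mul_le_mul (hC z h0 h1) (hD z h0 h1) (norm_nonneg _) ((norm_nonneg _).trans (hC z h0 h1))

lemma Good.sum {ι : Type*} (s : Finset ι) {f : ι → ℂ → ℂ} (hf : ∀ i, Good (f i)) :
    Good (fun z => ∑ i ∈ s, f i z) := by
  choose h1 C hC using hf
  refine ⟨by fun_prop, ∑ i ∈ s, C i, fun z h0 h1 => ?_⟩
  exact (norm_sum_le _ _).trans (Finset.sum_le_sum fun i _ => hC i z h0 h1)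

lemma Good.exp (a b c : ℝ) : Good (fun z => Complex.exp ((a + b * z) * c)) := by
  refine ⟨by fun_prop, Real.exp (|a * c| + |b * c|), fun z h0 h1 => ?_⟩
  rw [Complex.norm_exp]
  apply Real.exp_le_exp.mpr
  simp
  have h2 : b * z.re * c ≤ |b * c| := by
    calc b * z.re * c = z.re * (b * c) := by ring
      _ ≤ z.re * |b * c| := by gcongr; exact le_abs_self _
      _ ≤ 1 * |b * c| := by gcongr
      _ = _ := by ring
  have h3 := le_abs_self (a * c)
  rw [← abs_mul, ← abs_mul]
  linarith

def GoodM (M : ℂ → Matrix (Fin n) (Fin n) ℂ) : Prop := ∀ i j, Good (fun z => M z i j)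

lemma GoodM.const (M : Matrix (Fin n) (Fin n) ℂ) : GoodM (fun _ => M) := fun _ _ => Good.const _

lemma GoodM.mul {M N : ℂ → Matrix (Fin n) (Fin n) ℂ} (hM : GoodM M) (hN : GoodM N) :
    GoodM (fun z => M z * N z) := fun i j => by
  simp only [mul_apply]
  exact Good.sum _ fun k => (hM i k).mul (hN k j)

/-- complex powers -/
noncomputable def cp {A : Matrix (Fin n) (Fin n) ℂ} (hA : A.IsHermitian) (z : ℂ) :
    Matrix (Fin n) (Fin n) ℂ := hc hA (fun x => Complex.exp (z * Real.log x))

lemma GoodM.cp {A : Matrix (Fin n) (Fin n) ℂ} (hA : A.IsHermitian) (a b : ℝ) :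
    GoodM (fun z => cp hA (a + b * z)) := by
  unfold TraceAux.cp hc
  refine GoodM.mul (GoodM.mul (GoodM.const _) ?_) (GoodM.const _)
  intro i j
  by_cases h : i = j
  · subst h
    simp only [diagonal_apply_eq]
    exact Good.exp _ _ _
  · simp only [diagonal_apply_ne _ h]
    exact Good.const _

section
variable {A : Matrix (Fin n) (Fin n) ℂ} (hA : A.IsHermitian)
lemma cp_add (z w : ℂ) : cp hA z * cp hA w = cp hA (z + w) := by
  unfold cp
  rw [hc_mul]
  simp only [← Complex.exp_add, add_mul]

lemma cp_zero : cp hA 0 = 1 := by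
  unfold cp; simpa using hc_one hA

lemma cp_star (z : ℂ) : (cp hA z)ᴴ = cp hA (star z) := by
  unfold cp
  rw [hc_star]
  congr 1; ext x
  simp [← Complex.exp_conj]

lemma cp_unit (y : ℝ) : cp hA (y * Complex.I) * (cp hA (y * Complex.I))ᴴ = 1 := by
  rw [cp_star, cp_add, ← cp_zero hA]
  congr 1
  simp

lemma cp_real_fun (r : ℝ) : cp hA r = hc hA (fun x => ((Real.exp (r * Real.log x) : ℝ) : ℂ)) := by
  unfold cp; congr 1; ext x; push_cast; rfl
end

lemma cp_real {A : Matrix (Fin n) (Fin n) ℂ} (hA : A.PosDef) (r : ℝ) :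
    cp hA.isHermitian r = matrixRpow A r := by
  unfold matrixRpow
  rw [cfc_eq_hc hA.isHermitian, cp_real_fun]
  apply hc_congr
  intro i
  rw [Real.rpow_def_of_pos (hA.eigenvalues_pos i), mul_comm]

lemma cp_one {A : Matrix (Fin n) (Fin n) ℂ} (hA : A.PosDef) :
    cp hA.isHermitian 1 = A := by
  have := cp_real hA 1
  simp only [Complex.ofReal_one] at this
  rw [this, matrixRpow]
  simp only [Real.rpow_one]
  exact cfc_id' ℝ A hA.isHermitian.isSelfAdjoint

lemma cp_posDef {A : Matrix (Fin n) (Fin n) ℂ} (hA : A.PosDef) (r : ℝ) :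
    (cp hA.isHermitian r).PosDef := by
  have h1 : cp hA.isHermitian r = (cp hA.isHermitian (r/2 : ℝ))ᴴ * cp hA.isHermitian (r/2 : ℝ) := by
    rw [cp_star, cp_add]; congr 1; simp
  rw [h1]
  apply Matrix.PosDef.conjTranspose_mul_self
  rw [mulVec_injective_iff_isUnit]
  refine IsUnit.of_mul_eq_one (cp hA.isHermitian (-(r/2 : ℝ))) ?_
  rw [cp_add, add_neg_cancel, cp_zero]

lemma sandwich_posDef {A B : Matrix (Fin n) (Fin n) ℂ} (hA : A.PosDef) (hB : B.PosDef) (r s : ℝ) :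
    (cp hA.isHermitian r * cp hB.isHermitian s * cp hA.isHermitian r).PosDef := by
  have h1 : cp hA.isHermitian r * cp hB.isHermitian s * cp hA.isHermitian r =
     (cp hB.isHermitian (s/2 : ℝ) * cp hA.isHermitian r)ᴴ *
      (cp hB.isHermitian (s/2 : ℝ) * cp hA.isHermitian r) := by
    have e : cp hB.isHermitian s = cp hB.isHermitian (s/2 : ℝ) * cp hB.isHermitian (s/2 : ℝ) := by
      rw [cp_add]; congr 1; simp
    rw [conjTranspose_mul, cp_star, cp_star, e]
    simp [mul_assoc]
  rw [h1]
  apply Matrix.PosDef.conjTranspose_mul_self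
  rw [mulVec_injective_iff_isUnit]
  refine IsUnit.of_mul_eq_one (cp hA.isHermitian (-r) * cp hB.isHermitian (-(s/2 : ℝ))) ?_
  rw [mul_assoc, ← mul_assoc (cp hA.isHermitian r), cp_add, add_neg_cancel, cp_zero, one_mul,
    cp_add, add_neg_cancel, cp_zero]


lemma polar {K P : Matrix (Fin n) (Fin n) ℂ} (hP : P.PosDef) (h : Kᴴ * K = P) :
    ∃ V : Matrix (Fin n) (Fin n) ℂ, V * Vᴴ = 1 ∧ V * cp hP.isHermitian ((1 / 2 : ℝ) : ℂ) = K := by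
  refine ⟨K * cp hP.isHermitian ((-(1 / 2) : ℝ) : ℂ), ?_, ?_⟩
  · apply mul_eq_one_comm.mp
    have e : Kᴴ * K = cp hP.isHermitian 1 := by rw [h, cp_one hP]
    rw [conjTranspose_mul, mul_assoc, ← mul_assoc Kᴴ, e, cp_star, cp_add, cp_add,
      ← cp_zero hP.isHermitian]
    congr 1
    simp
    norm_num
  · rw [mul_assoc, cp_add]
    have : (((-(1 / 2) : ℝ) : ℂ) + ((1 / 2 : ℝ) : ℂ)) = 0 := by push_cast; ring
    rw [this, cp_zero, mul_one]

lemma sandwich_eq {A B : Matrix (Fin n) (Fin n) ℂ} (hA : A.IsHermitian) (hB : B.IsHermitian)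
    (r s : ℝ) : (cp hB (s / 2 : ℝ) * cp hA r)ᴴ * (cp hB (s / 2 : ℝ) * cp hA r)
      = cp hA r * cp hB s * cp hA r := by
  have e : cp hB s = cp hB (s/2 : ℝ) * cp hB (s/2 : ℝ) := by
    rw [cp_add]; congr 1; simp
  rw [conjTranspose_mul, cp_star, cp_star, e]
  simp [mul_assoc]

set_option maxHeartbeats 2000000 in
lemma alt {A B P Q : Matrix (Fin n) (Fin n) ℂ} (hA : A.PosDef) (hB : B.PosDef)
    (hP : P.PosDef) (hQ : Q.PosDef) {θ p : ℝ} (hθ0 : 0 < θ) (hθ1 : θ ≤ 1) (hp : 1 ≤ p)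
    (eP : cp hA.isHermitian (θ / 2 : ℝ) * cp hB.isHermitian θ * cp hA.isHermitian (θ / 2 : ℝ) = P)
    (eQ : cp hA.isHermitian (1 / 2 : ℝ) * B * cp hA.isHermitian (1 / 2 : ℝ) = Q) :
    ∑ i, hP.isHermitian.eigenvalues i ^ (p / (2 * θ)) ≤
      ∑ i, hQ.isHermitian.eigenvalues i ^ (p / 2) := by
  rcases isEmpty_or_nonempty (Fin n) with hn | hn
  · simp
  have p0 : 0 < p := by linarith
  obtain ⟨V, hV, eV⟩ := polar (K := cp hB.isHermitian (θ / 2 : ℝ) * cp hA.isHermitian (θ / 2 : ℝ)) hP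
    (by rw [sandwich_eq, eP])
  obtain ⟨W, hW, eW⟩ := polar (K := cp hB.isHermitian (1 / 2 : ℝ) * cp hA.isHermitian (1 / 2 : ℝ)) hQ
    (by rw [sandwich_eq, ← eQ, Complex.ofReal_one, cp_one hB])
  set a := hA.isHermitian
  set b := hB.isHermitian
  set u := hP.isHermitian with hu
  set v := hQ.isHermitian with hv
  set T := ∑ i, u.eigenvalues i ^ (p / (2 * θ)) with hT
  set S := ∑ i, v.eigenvalues i ^ (p / 2) with hS
  have upos : ∀ i, 0 < u.eigenvalues i := hP.eigenvalues_pos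
  have vpos : ∀ i, 0 < v.eigenvalues i := hQ.eigenvalues_pos
  have Tpos : 0 < T := Finset.sum_pos (fun i _ => Real.rpow_pos_of_pos (upos i) _) Finset.univ_nonempty
  have Spos : 0 < S := Finset.sum_pos (fun i _ => Real.rpow_pos_of_pos (vpos i) _) Finset.univ_nonempty
  let M : ℂ → Matrix (Fin n) (Fin n) ℂ := fun z =>
    Vᴴ * cp b ((0 : ℝ) + (1 / 2 : ℝ) * z) * cp a ((0 : ℝ) + (1 / 2 : ℝ) * z) *
      cp u ((p / (2 * θ) : ℝ) + (-(1 / (2 * θ)) : ℝ) * z)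
  let f : ℂ → ℂ := fun z => (M z).trace
  have hM : GoodM M := (((GoodM.const _).mul (GoodM.cp b _ _)).mul (GoodM.cp a _ _)).mul
    (GoodM.cp u _ _)
  have hf : Good f := Good.sum _ fun i => hM i i
  have hfθ : f θ = (T : ℂ) := by
    simp only [f, M]
    have e1 : ((0 : ℝ) : ℂ) + (1 / 2 : ℝ) * θ = (θ / 2 : ℝ) := by push_cast; ring
    rw [e1, mul_assoc Vᴴ, ← eV, ← mul_assoc, mul_eq_one_comm.mp hV, one_mul, cp_add]
    have e2 : ((1 / 2 : ℝ) : ℂ) + ((p / (2 * θ) : ℝ) + (-(1 / (2 * θ)) : ℝ) * θ) =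
      ((p / (2 * θ) : ℝ) : ℂ) := by
      rw [← Complex.ofReal_mul, ← Complex.ofReal_add, ← Complex.ofReal_add]
      congr 1
      field_simp
      ring
    rw [e2, cp_real_fun, hc_trace, hT]
    push_cast
    refine Finset.sum_congr rfl fun i _ => ?_
    rw [Real.rpow_def_of_pos (upos i)]
    push_cast
    rw [mul_comm]
  set C := S / p + (1 - 1 / p) * T with hC
  have hp1 : 0 ≤ 1 - 1 / p := by
    rw [sub_nonneg, div_le_one p0]; exact hp
  have Cpos : 0 < C := by positivity
  have key := Complex.HadamardThreeLines.norm_le_interp_of_mem_verticalClosedStrip₀₁' f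
    (z := θ) (a := T) (b := C) ⟨by simpa using hθ0.le, by simpa using hθ1⟩ hf.1.diffContOnCl
    (by
      obtain ⟨D, hD⟩ := hf.2
      refine ⟨D, ?_⟩
      rintro _ ⟨z, hz, rfl⟩
      exact hD z hz.1 hz.2)
    (by
      intro z hz
      have hz' : z = z.im * Complex.I := by
        apply Complex.ext <;> simp
        simpa using hz
      generalize z.im = y at hz'
      subst hz'
      have e : f (y * Complex.I) = ((Vᴴ * cp b ((y / 2 : ℝ) * Complex.I) *
          cp a ((y / 2 : ℝ) * Complex.I) * cp u ((-(y / (2 * θ)) : ℝ) * Complex.I)) *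
            hc u (fun _ => ((1 : ℝ) : ℂ)) * 1 *
            hc u (fun x => ((Real.exp ((p / (2 * θ)) * Real.log x) : ℝ) : ℂ))).trace := by
        rw [← cp_real_fun, Complex.ofReal_one, hc_one, mul_one, mul_one, mul_assoc _ _ (cp u _),
          cp_add]
        simp only [f, M]
        congr 2
        · congr 2
          · congr 1; push_cast; ring
          · push_cast; ring
        · congr 1; push_cast; ring
      rw [e]
      refine (young u u (unit_mul (unit_mul (unit_mul (unit_star hV) (cp_unit b _)) (cp_unit a _))
        (cp_unit u _)) (by simp) (fun _ => 1) _ (fun _ => 0)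
          (fun i => u.eigenvalues i ^ (p / (2 * θ))) ?_).trans (by simp [hT])
      intro i j
      rw [one_mul, zero_add, Real.abs_exp, Real.rpow_def_of_pos (upos j), mul_comm])
    (by
      intro z hz
      have hz' : z = 1 + z.im * Complex.I := by
        apply Complex.ext <;> simp
        simpa using hz
      generalize z.im = y at hz'
      subst hz'
      have e : f (1 + y * Complex.I) = ((Vᴴ * cp b ((y / 2 : ℝ) * Complex.I) * W) *
            hc v (fun x => ((Real.exp ((1 / 2) * Real.log x) : ℝ) : ℂ)) *
            (cp a ((y / 2 : ℝ) * Complex.I) * cp u ((-(y / (2 * θ)) : ℝ) * Complex.I)) *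
            hc u (fun x => ((Real.exp (((p - 1) / (2 * θ)) * Real.log x) : ℝ) : ℂ))).trace := by
        rw [← cp_real_fun, ← cp_real_fun, mul_assoc (Vᴴ * _), eW]
        simp only [f, M]
        have e1 : ((0 : ℝ) : ℂ) + (1 / 2 : ℝ) * (1 + y * Complex.I) =
          (y / 2 : ℝ) * Complex.I + (1 / 2 : ℝ) := by push_cast; ring
        have e1' : (y / 2 : ℝ) * Complex.I + (1 / 2 : ℝ) =
          (1 / 2 : ℝ) + (y / 2 : ℝ) * Complex.I := by ring
        have e2 : ((p / (2 * θ) : ℝ) : ℂ) + (-(1 / (2 * θ)) : ℝ) * (1 + y * Complex.I) =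
          (-(y / (2 * θ)) : ℝ) * Complex.I + ((p - 1) / (2 * θ) : ℝ) := by push_cast; ring
        rw [e2, e1, ← cp_add b, e1', ← cp_add a, ← cp_add u]
        simp only [mul_assoc]
      rw [e]
      refine (young v u (unit_mul (unit_mul (unit_star hV) (cp_unit b _)) hW)
        (unit_mul (cp_unit a _) (cp_unit u _)) _ _
          (fun i => 1 / p * v.eigenvalues i ^ (p / 2))
          (fun i => (1 - 1 / p) * u.eigenvalues i ^ (p / (2 * θ))) ?_).trans ?_
      · intro i j
        have := Real.geom_mean_le_arith_mean2_weighted (w₁ := 1 / p) (w₂ := 1 - 1 / p)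
          (p₁ := v.eigenvalues i ^ (p / 2)) (p₂ := u.eigenvalues j ^ (p / (2 * θ)))
          (by positivity) hp1 (Real.rpow_nonneg (vpos i).le _) (Real.rpow_nonneg (upos j).le _)
          (by ring)
        refine le_trans (le_of_eq ?_) this
        rw [abs_of_pos (by positivity), ← Real.rpow_mul (vpos i).le, ← Real.rpow_mul (upos j).le,
          Real.rpow_def_of_pos (vpos i), Real.rpow_def_of_pos (upos j)]
        congr 2
        · field_simp
        · field_simp
      · rw [← Finset.mul_sum, ← Finset.mul_sum, hC, hT, hS]
        apply le_of_eq; ring)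
  rw [hfθ, Complex.norm_real, Real.norm_of_nonneg Tpos.le, Complex.ofReal_re] at key
  have h1 : T ≤ C := by
    have h2 : T = T ^ (1 - θ) * T ^ θ := by
      rw [← Real.rpow_add Tpos]; simp
    have h3 : T ^ θ ≤ C ^ θ := by
      have h4 : T ^ (1 - θ) * T ^ θ ≤ T ^ (1 - θ) * C ^ θ := by rw [← h2]; exact key
      exact le_of_mul_le_mul_left h4 (Real.rpow_pos_of_pos Tpos _)
    exact (Real.rpow_le_rpow_iff Tpos.le Cpos.le hθ0).mp h3
  have h5 : T / p ≤ S / p := by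
    rw [hC] at h1
    have : T / p = T - (1 - 1 / p) * T := by ring
    linarith
  exact (div_le_div_iff_of_pos_right p0).mp h5


lemma norm_pow_sub_pow_le' {R : Type*} [NormedRing R] [NormOneClass R] (x y : R) (K : ℝ) (hK : 1 ≤ K)
    (hx : ‖x‖ ≤ K) (hy : ‖y‖ ≤ K) (m : ℕ) : ‖x ^ m - y ^ m‖ ≤ m * K ^ m * ‖x - y‖ := by
  induction m with
  | zero => simp
  | succ k ih =>
    have e : x ^ (k+1) - y ^ (k+1) = x ^ k * (x - y) + (x ^ k - y ^ k) * y := by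
      rw [pow_succ, pow_succ]; noncomm_ring
    rw [e]
    have h0 : 0 ≤ K := by linarith
    calc ‖x ^ k * (x - y) + (x ^ k - y ^ k) * y‖
        ≤ ‖x ^ k‖ * ‖x - y‖ + ‖x ^ k - y ^ k‖ * ‖y‖ :=
          (norm_add_le _ _).trans (add_le_add (norm_mul_le _ _) (norm_mul_le _ _))
      _ ≤ K ^ k * ‖x - y‖ + (k * K ^ k * ‖x - y‖) * K := by
          gcongr
          exact (norm_pow_le x k).trans (by gcongr)
      _ ≤ K ^ (k+1) * ‖x - y‖ + (k * K ^ k * ‖x - y‖) * K := by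
          gcongr
          omega
      _ = _ := by push_cast; ring

open Filter Topology in
lemma trotter_aux {R : Type*} [NormedRing R] [NormOneClass R] [NormedAlgebra ℝ R] [CompleteSpace R]
    (G : ℝ → R) (Z : R) (h0 : G 0 = 1) (hG : HasDerivAt G Z 0) :
    Tendsto (fun m : ℕ => G (1 / (m : ℝ)) ^ m) atTop (𝓝 (NormedSpace.exp Z)) := by
  let _ : NormedAlgebra ℚ R := NormedAlgebra.restrictScalars ℚ ℝ R
  have hE : HasDerivAt (fun t : ℝ => NormedSpace.exp (t • Z)) Z 0 := by
    simpa using hasDerivAt_exp_smul_const (𝕂 := ℝ) Z (0 : ℝ)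
  set E : ℝ → R := fun t => NormedSpace.exp (t • Z) with hEdef
  have E0 : E 0 = 1 := by simp [E]
  have bound : ∀ H : ℝ → R, H 0 = 1 → HasDerivAt H Z 0 →
      ∀ᶠ t in 𝓝 (0 : ℝ), ‖H t‖ ≤ Real.exp ((‖Z‖ + 1) * |t|) := by
    intro H H0 hH
    have := (hasDerivAt_iff_isLittleO_nhds_zero.mp hH).def (c := 1) one_pos
    filter_upwards [this] with t ht
    simp only [zero_add, H0, Real.norm_eq_abs, one_mul] at ht
    have e : H t = (H t - 1 - t • Z) + 1 + t • Z := by abel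
    have h1 : ‖H t‖ ≤ |t| + 1 + |t| * ‖Z‖ := by
      rw [e]
      refine (norm_add_le _ _).trans (add_le_add ((norm_add_le _ _).trans (add_le_add ht ?_)) ?_)
      · simp
      · rw [norm_smul, Real.norm_eq_abs]
    have h2 := Real.add_one_le_exp ((‖Z‖ + 1) * |t|)
    nlinarith
  have hlim : Tendsto (fun m : ℕ => 1 / (m : ℝ)) atTop (𝓝 0) := tendsto_one_div_atTop_nhds_zero_nat
  have hdiff : (fun t : ℝ => G t - E t) =o[𝓝 0] (fun t => t) := by
    have := hasDerivAt_iff_isLittleO_nhds_zero.mp (hG.sub hE)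
    simpa [h0, E0] using this
  have hm := hlim.eventually (bound G h0 hG)
  have hm2 := hlim.eventually (bound E E0 hE)
  have hEm : ∀ᶠ m : ℕ in atTop, E (1 / (m : ℝ)) ^ m = NormedSpace.exp Z := by
    filter_upwards [eventually_gt_atTop 0] with m hm
    simp only [E]
    rw [← NormedSpace.exp_nsmul]
    congr 1
    rw [← Nat.cast_smul_eq_nsmul ℝ, smul_smul]
    have : (m : ℝ) ≠ 0 := by positivity
    rw [mul_one_div_cancel this, one_smul]
  rw [tendsto_iff_norm_sub_tendsto_zero]
  rw [Metric.tendsto_nhds]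
  intro ε hε
  set c := Real.exp (‖Z‖ + 1) with hc
  have cpos : 0 < c := Real.exp_pos _
  have hd := hlim.eventually (hdiff.def (c := ε / (2 * c)) (by positivity))
  filter_upwards [hm, hm2, hEm, hd, eventually_gt_atTop 0] with m h1 h2 h3 h4 hmpos
  have mp : (0 : ℝ) < m := by exact_mod_cast hmpos
  rw [Real.dist_eq, sub_zero, abs_of_nonneg (norm_nonneg _), ← h3]
  have habs : |1 / (m : ℝ)| = 1 / m := abs_of_pos (by positivity)
  rw [habs] at h1 h2
  rw [Real.norm_eq_abs, habs] at h4
  have h5 := norm_pow_sub_pow_le' _ _ _ (Real.one_le_exp (by positivity)) h1 h2 m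
  rw [← Real.exp_nat_mul] at h5
  have h6 : (m : ℝ) * ((‖Z‖ + 1) * (1 / m)) = ‖Z‖ + 1 := by field_simp
  rw [h6] at h5
  calc _ ≤ _ := h5
    _ ≤ m * c * (ε / (2 * c) * (1 / m)) := by gcongr
    _ = ε / 2 := by field_simp
    _ < ε := by linarith

section
open scoped Matrix.Norms.L2Operator
open Filter Topology

lemma cfc_exp_smul {X : Matrix (Fin n) (Fin n) ℂ} (hX : X.IsHermitian) (r : ℝ) :
    cfc (fun x : ℝ => Real.exp (r * x)) X = NormedSpace.exp (r • X) := by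
  have h1 : cfc Real.exp (r • X) = NormedSpace.exp (r • X) :=
    CFC.real_exp_eq_normedSpace_exp ((IsSelfAdjoint.all r).smul hX.isSelfAdjoint)
  rw [← h1, ← cfc_comp_smul r Real.exp X (by fun_prop) hX.isSelfAdjoint]
  simp [smul_eq_mul]

lemma trotter {X Y : Matrix (Fin n) (Fin n) ℂ} [Nonempty (Fin n)] :
    Tendsto (fun m : ℕ => (NormedSpace.exp ((1 / (m : ℝ) / 2) • X) *
      NormedSpace.exp ((1 / (m : ℝ)) • Y) * NormedSpace.exp ((1 / (m : ℝ) / 2) • X)) ^ m) atTop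
      (𝓝 (NormedSpace.exp (X + Y))) := by
  have hd : ∀ Z : Matrix (Fin n) (Fin n) ℂ,
      HasDerivAt (fun t : ℝ => NormedSpace.exp (t • Z)) Z 0 := fun Z => by
    simpa using hasDerivAt_exp_smul_const (𝕂 := ℝ) Z (0 : ℝ)
  have hd2 : HasDerivAt (fun t : ℝ => NormedSpace.exp ((t / 2) • X)) ((1 / 2 : ℝ) • X) 0 := by
    have := hd ((1 / 2 : ℝ) • X)
    refine this.congr_of_eventuallyEq (Eventually.of_forall fun t => ?_)
    simp only [smul_smul]
    congr 2; ring
  have hG := (hd2.mul (hd Y)).mul hd2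
  have := trotter_aux (fun t : ℝ => NormedSpace.exp ((t / 2) • X) *
      NormedSpace.exp (t • Y) * NormedSpace.exp ((t / 2) • X)) (X + Y) (by simp) (by
        have e : X + Y = ((1 / 2 : ℝ) • X * NormedSpace.exp ((0 : ℝ) • Y) +
            NormedSpace.exp (((0 : ℝ) / 2) • X) * Y) * NormedSpace.exp (((0 : ℝ) / 2) • X) +
            (NormedSpace.exp (((0 : ℝ) / 2) • X) * NormedSpace.exp ((0 : ℝ) • Y)) *
              ((1 / 2 : ℝ) • X) := by
          rw [zero_div, zero_smul, zero_smul, NormedSpace.exp_zero]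
          simp only [mul_one, one_mul]
          rw [add_right_comm, ← add_smul]
          norm_num
        rw [e]
        exact hG)
  exact this
end


lemma cfc_posDef {X : Matrix (Fin n) (Fin n) ℂ} (hX : X.IsHermitian) :
    (cfc Real.exp X).PosDef := by
  have e : cfc Real.exp X = (hc hX (fun x => ((Real.exp (x / 2) : ℝ) : ℂ)))ᴴ *
      hc hX (fun x => ((Real.exp (x / 2) : ℝ) : ℂ)) := by
    rw [hc_star, hc_mul, cfc_eq_hc hX]
    congr 1; ext x
    rw [RCLike.star_def, Complex.conj_ofReal, ← Complex.ofReal_mul, ← Real.exp_add]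
    congr 2; ring
  rw [e]
  apply Matrix.PosDef.conjTranspose_mul_self
  rw [mulVec_injective_iff_isUnit]
  refine IsUnit.of_mul_eq_one (hc hX (fun x => ((Real.exp (-(x / 2)) : ℝ) : ℂ))) ?_
  rw [hc_mul, ← hc_one hX]
  congr 1; ext x
  rw [← Complex.ofReal_mul, ← Real.exp_add]
  simp

lemma cp_exp {X : Matrix (Fin n) (Fin n) ℂ} (hX : X.IsHermitian) (r : ℝ) :
    cp (cfc_posDef hX).isHermitian r = NormedSpace.exp (r • X) := by
  rw [cp_real (cfc_posDef hX), matrixRpow, ← cfc_exp_smul hX]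
  rw [← cfc_comp (fun x : ℝ => x ^ r) Real.exp X hX.isSelfAdjoint
    (by intro x hx
        obtain ⟨y, -, rfl⟩ := hx
        exact (Real.continuousAt_rpow_const _ _ (Or.inl (Real.exp_pos y).ne')).continuousWithinAt)
    (by fun_prop)]
  congr 1; ext x
  simp only [Function.comp]
  rw [← Real.exp_mul, mul_comm]

lemma trace_pow {P : Matrix (Fin n) (Fin n) ℂ} (hP : P.IsHermitian) (m : ℕ) :
    (P ^ m).trace = ((∑ i, hP.eigenvalues i ^ m : ℝ) : ℂ) := by
  have := cfc_pow_id (R := ℝ) P m hP.isSelfAdjoint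
  rw [← this, cfc_eq_hc hP, hc_trace]
  push_cast; rfl

open Filter Topology in
lemma golden {X Y : Matrix (Fin n) (Fin n) ℂ} (hX : X.IsHermitian) (hY : Y.IsHermitian) :
    (cfc Real.exp (X + Y)).trace.re ≤ (cfc Real.exp X * cfc Real.exp Y).trace.re := by
  rcases isEmpty_or_nonempty (Fin n) with hn | hn
  · simp [Matrix.trace]
  have hXY := hX.add hY
  have e1 : cfc Real.exp (X + Y) = NormedSpace.exp (X + Y) := by
    have := cfc_exp_smul hXY 1
    simpa using this
  have hlim := (((Continuous.matrix_trace continuous_id).tendsto _).comp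
    (trotter (X := X) (Y := Y)))
  have hlim2 := (Complex.continuous_re.tendsto _).comp hlim
  rw [e1]
  refine le_of_tendsto hlim2 ?_
  filter_upwards [eventually_gt_atTop 0] with m hm
  have mp : (0 : ℝ) < m := by exact_mod_cast hm
  have m1 : (1 : ℝ) ≤ m := by exact_mod_cast hm
  have hA := cfc_posDef hX
  have hB := cfc_posDef hY
  have hP := sandwich_posDef hA hB (1 / (m : ℝ) / 2) (1 / (m : ℝ))
  have hQ := sandwich_posDef hA hB (1 / 2) 1
  have key := alt hA hB hP hQ (θ := 1 / (m : ℝ)) (p := 2) (by positivity)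
    (by rw [div_le_one mp]; exact m1) (by norm_num) rfl
    (by rw [Complex.ofReal_one, cp_one hB])
  have e2 : (2 : ℝ) / (2 * (1 / (m : ℝ))) = (m : ℝ) := by field_simp
  rw [e2] at key
  simp only [Real.rpow_natCast] at key
  have k1 := trace_pow hP.isHermitian m
  have k2 := trace_pow hQ.isHermitian 1
  have k3 : (cp hA.isHermitian ((1 / 2 : ℝ) : ℂ) * cp hB.isHermitian ((1 : ℝ) : ℂ) *
      cp hA.isHermitian ((1 / 2 : ℝ) : ℂ)).trace = (cfc Real.exp X * cfc Real.exp Y).trace := by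
    rw [trace_mul_comm, ← mul_assoc, cp_add]
    have : (((1 / 2 : ℝ) : ℂ) + ((1 / 2 : ℝ) : ℂ)) = 1 := by push_cast; ring
    rw [this, Complex.ofReal_one, cp_one hA, cp_one hB]
  rw [pow_one, k3] at k2
  rw [k2, Complex.ofReal_re]
  simp only [Function.comp, id]
  rw [← cp_exp hX, ← cp_exp hY, k1, Complex.ofReal_re]
  refine key.trans (le_of_eq ?_)
  refine Finset.sum_congr rfl fun i _ => ?_
  norm_num


/-- overlap weights of the two eigenbases -/
noncomputable def wt {A B : Matrix (Fin n) (Fin n) ℂ} (hA : A.IsHermitian) (hB : B.IsHermitian)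
    (i j : Fin n) : ℝ :=
  ‖((hA.eigenvectorUnitary : Matrix (Fin n) (Fin n) ℂ)ᴴ *
    (hB.eigenvectorUnitary : Matrix (Fin n) (Fin n) ℂ)) i j‖ ^ 2

section
variable {A B : Matrix (Fin n) (Fin n) ℂ} (hA : A.IsHermitian) (hB : B.IsHermitian)

lemma wt_nonneg (i j : Fin n) : 0 ≤ wt hA hB i j := by unfold wt; positivity

lemma wt_row (i : Fin n) : ∑ j, wt hA hB i j = 1 :=
  unitary_row (unit_mul (unit_star (UUs hA)) (UUs hB)) i

lemma wt_col (j : Fin n) : ∑ i, wt hA hB i j = 1 :=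
  unitary_col (unit_mul (unit_star (UUs hA)) (UUs hB)) j

lemma trace_prod (f g : ℝ → ℝ) : (cfc f A * cfc g B).trace =
    ((∑ i, ∑ j, wt hA hB i j * (f (hA.eigenvalues i) * g (hB.eigenvalues j)) : ℝ) : ℂ) := by
  rw [cfc_eq_hc hA, cfc_eq_hc hB]
  unfold hc
  set U := (hA.eigenvectorUnitary : Matrix (Fin n) (Fin n) ℂ) with hU
  set V := (hB.eigenvectorUnitary : Matrix (Fin n) (Fin n) ℂ) with hV
  have e : (U * diagonal (fun i => (f (hA.eigenvalues i) : ℂ)) * Uᴴ *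
      (V * diagonal (fun i => (g (hB.eigenvalues i) : ℂ)) * Vᴴ)).trace =
      (diagonal (fun i => (f (hA.eigenvalues i) : ℂ)) * ((Uᴴ * V) *
        diagonal (fun i => (g (hB.eigenvalues i) : ℂ)) * (Uᴴ * V)ᴴ)).trace := by
    rw [conjTranspose_mul, conjTranspose_conjTranspose, mul_assoc, mul_assoc, trace_mul_comm U]
    simp only [mul_assoc]
  rw [e]
  push_cast
  simp only [trace, diag_apply, diagonal_mul]
  refine Finset.sum_congr rfl fun i _ => ?_
  rw [mul_apply, Finset.mul_sum]
  refine Finset.sum_congr rfl fun j _ => ?_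
  rw [mul_diagonal, conjTranspose_apply]
  unfold wt
  rw [← hU, ← hV]
  have := Complex.mul_conj' ((Uᴴ * V) i j)
  push_cast
  rw [← this, RCLike.star_def]
  ring
end

lemma trace_cfc {A : Matrix (Fin n) (Fin n) ℂ} (hA : A.IsHermitian) (f : ℝ → ℝ) :
    (cfc f A).trace = ((∑ i, f (hA.eigenvalues i) : ℝ) : ℂ) := by
  rw [cfc_eq_hc hA, hc_trace]; push_cast; rfl

lemma golden_sum {A B : Matrix (Fin n) (Fin n) ℂ} (hA : A.IsHermitian) (hB : B.IsHermitian)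
    (hC : (A + B).IsHermitian) (t : ℝ) :
    ∑ k, Real.exp (-t * hC.eigenvalues k) ≤
      ∑ i, ∑ j, wt hA hB i j * (Real.exp (-t * hA.eigenvalues i) * Real.exp (-t * hB.eigenvalues j)) := by
  have sm : ∀ {X : Matrix (Fin n) (Fin n) ℂ}, X.IsHermitian → ((-t) • X).IsHermitian :=
    fun hX => ((IsSelfAdjoint.all (-t)).smul hX.isSelfAdjoint)
  have e : ∀ {X : Matrix (Fin n) (Fin n) ℂ}, X.IsHermitian →
      cfc Real.exp ((-t) • X) = cfc (fun x => Real.exp (-t * x)) X := by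
    intro X hX
    rw [cfc_exp_smul hX]
    have := cfc_exp_smul (sm hX) 1
    simpa using this
  have := golden (sm hA) (sm hB)
  rw [← smul_add, e hA, e hB, e hC, trace_prod hA hB, trace_cfc hC, Complex.ofReal_re,
    Complex.ofReal_re] at this
  exact this

lemma scalar_ineq {a b : ℝ} (ha : 0 < a) (hb : 0 < b) :
    (1 - Real.exp (-a)) * (1 - Real.exp (-b)) ≤ (1 - Real.exp (-√(a * b))) ^ 2 := by
  have pos : ∀ x : ℝ, 0 < x → 0 < 1 - Real.exp (-x) := fun x hx => by
    have : Real.exp (-x) < 1 := Real.exp_lt_one_iff.mpr (by linarith)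
    linarith
  have hder : ∀ u : ℝ, HasDerivAt (fun u => Real.log (1 - Real.exp (-Real.exp u)))
      (Real.exp u / (Real.exp (Real.exp u) - 1)) u := by
    intro u
    have h0 : HasDerivAt (fun y => -Real.exp y) (-Real.exp u) u := (Real.hasDerivAt_exp u).neg
    have h1 : HasDerivAt (fun u => Real.log (1 - Real.exp (-Real.exp u)))
      (-(Real.exp (-Real.exp u) * -Real.exp u) / (1 - Real.exp (-Real.exp u))) u :=
      (h0.exp.const_sub 1).log (pos _ (Real.exp_pos u)).ne'
    refine h1.congr_deriv ?_
    symm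
    have h2 := (pos _ (Real.exp_pos u)).ne'
    have h3 : Real.exp (Real.exp u) - 1 ≠ 0 := by
      have := Real.add_one_le_exp (Real.exp u)
      have := Real.exp_pos u
      intro h; linarith
    rw [div_eq_div_iff h3 h2]
    simp only [Real.exp_neg] at *
    field_simp
  have hconc : ConcaveOn ℝ Set.univ (fun u => Real.log (1 - Real.exp (-Real.exp u))) := by
    apply Antitone.concaveOn_univ_of_deriv (fun u => (hder u).differentiableAt)
    have : deriv (fun u => Real.log (1 - Real.exp (-Real.exp u))) =
      fun u => (Real.exp u / (Real.exp (Real.exp u) - 1)) := funext fun u => (hder u).deriv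
    rw [this]
    intro u v huv
    show Real.exp v / (Real.exp (Real.exp v) - 1) ≤ Real.exp u / (Real.exp (Real.exp u) - 1)
    have hx := Real.exp_pos u
    have hy := Real.exp_pos v
    have hxy := Real.exp_le_exp.mpr huv
    generalize Real.exp u = x at hx hxy ⊢
    generalize Real.exp v = y at hy hxy ⊢
    have hx1 := Real.add_one_lt_exp hx.ne'
    have hy1 := Real.add_one_lt_exp hy.ne'
    rw [div_le_div_iff₀ (by linarith) (by linarith)]
    have hc := convexOn_exp.2 (Set.mem_univ (0:ℝ)) (Set.mem_univ y)
      (show (0:ℝ) ≤ 1 - x / y by rw [sub_nonneg, div_le_one hy]; exact hxy)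
      (show (0:ℝ) ≤ x / y by positivity) (by ring)
    simp only [smul_eq_mul, mul_zero, zero_add, Real.exp_zero, mul_one] at hc
    rw [div_mul_cancel₀ _ hy.ne'] at hc
    have h5 : y * Real.exp x ≤ y * (1 - x / y + x / y * Real.exp y) := by gcongr
    have h6 : y * (1 - x / y + x / y * Real.exp y) = y - x + x * Real.exp y := by field_simp
    linarith
  have h := hconc.2 (Set.mem_univ (Real.log a)) (Set.mem_univ (Real.log b))
    (show (0:ℝ) ≤ 1 / 2 by norm_num) (show (0:ℝ) ≤ 1 / 2 by norm_num) (by norm_num)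
  simp only [smul_eq_mul, Real.exp_log ha, Real.exp_log hb] at h
  have e : Real.exp (1 / 2 * Real.log a + 1 / 2 * Real.log b) = √(a * b) := by
    rw [← mul_add, ← Real.log_mul ha.ne' hb.ne', mul_comm, ← Real.rpow_def_of_pos (by positivity),
      Real.sqrt_eq_rpow]
  rw [e] at h
  have hs : 0 < √(a * b) := Real.sqrt_pos.mpr (by positivity)
  have pa := pos a ha
  have pb := pos b hb
  have ps := pos _ hs
  rw [← Real.log_le_log_iff (by positivity) (by positivity), Real.log_mul pa.ne' pb.ne', Real.log_pow]
  push_cast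
  linarith

lemma pointwise {A B : Matrix (Fin n) (Fin n) ℂ} (hA : A.PosDef) (hB : B.PosDef)
    (hC : (A + B).PosDef) {t : ℝ} (ht : 0 < t) :
    ∑ k, Real.exp (-(t * hC.isHermitian.eigenvalues k))
      - ∑ i, Real.exp (-(t * hA.isHermitian.eigenvalues i))
      - ∑ i, Real.exp (-(t * hB.isHermitian.eigenvalues i))
      ≤ ∑ i, ∑ j, wt hA.isHermitian hB.isHermitian i j *
        (Real.exp (-(t * (2 * √(hA.isHermitian.eigenvalues i * hB.isHermitian.eigenvalues j))))
        - 2 * Real.exp (-(t * √(hA.isHermitian.eigenvalues i * hB.isHermitian.eigenvalues j)))) := by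
  have h1 := golden_sum hA.isHermitian hB.isHermitian hC.isHermitian t
  have apos := hA.eigenvalues_pos
  have bpos := hB.eigenvalues_pos
  set a := hA.isHermitian.eigenvalues
  set b := hB.isHermitian.eigenvalues
  set w := wt hA.isHermitian hB.isHermitian with hw
  have h2 : ∑ i, ∑ j, w i j * (Real.exp (-t * a i) * Real.exp (-t * b j)) ≤
      ∑ i, ∑ j, w i j * (Real.exp (-(t * (2 * √(a i * b j)))) - 2 * Real.exp (-(t * √(a i * b j)))
        + Real.exp (-(t * a i)) + Real.exp (-(t * b j))) := by
    gcongr with i _ j _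
    · exact wt_nonneg _ _ i j
    · have := scalar_ineq (mul_pos ht (apos i)) (mul_pos ht (bpos j))
      have e : √(t * a i * (t * b j)) = t * √(a i * b j) := by
        rw [show t * a i * (t * b j) = t ^ 2 * (a i * b j) by ring, Real.sqrt_mul (by positivity),
          Real.sqrt_sq ht.le]
      rw [e] at this
      have e2 : Real.exp (-(t * (2 * √(a i * b j)))) = Real.exp (-(t * √(a i * b j))) ^ 2 := by
        rw [← Real.exp_nat_mul]; congr 1; push_cast; ring
      rw [e2, neg_mul, neg_mul]
      nlinarith
  have h3 : ∑ i, ∑ j, w i j * (Real.exp (-(t * (2 * √(a i * b j)))) - 2 * Real.exp (-(t * √(a i * b j)))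
        + Real.exp (-(t * a i)) + Real.exp (-(t * b j))) =
      ∑ i, ∑ j, w i j * (Real.exp (-(t * (2 * √(a i * b j)))) - 2 * Real.exp (-(t * √(a i * b j))))
        + ∑ i, Real.exp (-(t * a i)) + ∑ j, Real.exp (-(t * b j)) := by
    simp only [mul_add, Finset.sum_add_distrib]
    congr 1
    · congr 1
      refine Finset.sum_congr rfl fun i _ => ?_
      rw [← Finset.sum_mul, hw, wt_row, one_mul]
    · rw [Finset.sum_comm]
      refine Finset.sum_congr rfl fun i _ => ?_
      rw [← Finset.sum_mul, hw, wt_col, one_mul]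
  have h4 : ∑ k, Real.exp (-t * hC.isHermitian.eigenvalues k) =
    ∑ k, Real.exp (-(t * hC.isHermitian.eigenvalues k)) := by simp only [neg_mul]
  linarith


/-- integral representation predicate -/
def Rep (f : ℝ → ℝ) (v : ℝ) : Prop :=
  MeasureTheory.IntegrableOn f (Set.Ioi 0) ∧ ∫ t in Set.Ioi (0:ℝ), f t = v

lemma Rep.sub {f g : ℝ → ℝ} {u v : ℝ} (hf : Rep f u) (hg : Rep g v) :
    Rep (fun t => f t - g t) (u - v) :=
  ⟨hf.1.sub hg.1, by rw [MeasureTheory.integral_sub hf.1 hg.1, hf.2, hg.2]⟩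

lemma Rep.cmul {f : ℝ → ℝ} {u : ℝ} (hf : Rep f u) (c : ℝ) :
    Rep (fun t => c * f t) (c * u) :=
  ⟨hf.1.const_mul c, by rw [MeasureTheory.integral_const_mul, hf.2]⟩

lemma Rep.sum {ι : Type*} [Fintype ι] {f : ι → ℝ → ℝ} {u : ι → ℝ} (hf : ∀ i, Rep (f i) (u i)) :
    Rep (fun t => ∑ i, f i t) (∑ i, u i) :=
  ⟨MeasureTheory.integrable_finsetSum _ (fun i _ => (hf i).1), by
    rw [MeasureTheory.integral_finsetSum _ (fun i _ => (hf i).1)]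
    exact Finset.sum_congr rfl fun i _ => (hf i).2⟩

lemma Rep.mono {f g : ℝ → ℝ} {u v : ℝ} (hf : Rep f u) (hg : Rep g v)
    (h : ∀ t, 0 < t → f t ≤ g t) : u ≤ v := by
  rw [← hf.2, ← hg.2]
  exact MeasureTheory.setIntegral_mono_on hf.1 hg.1 measurableSet_Ioi fun t ht => h t ht

lemma Rep.scale {φ : ℝ → ℝ} {q c : ℝ} (h : Rep (fun t => t ^ (-q - 1) * φ t) c) {x : ℝ}
    (hx : 0 < x) : Rep (fun t => t ^ (-q - 1) * φ (t * x)) (c * x ^ q) := by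
  have h1 : Rep (fun t => (x * t) ^ (-q - 1) * φ (x * t)) (x⁻¹ * c) := by
    refine ⟨?_, ?_⟩
    · have := (MeasureTheory.integrableOn_Ioi_comp_mul_left_iff
        (fun t => t ^ (-q - 1) * φ t) 0 hx).mpr (by simpa using h.1)
      exact this
    · have := MeasureTheory.integral_comp_mul_left_Ioi (fun t => t ^ (-q - 1) * φ t) 0 hx
      rw [this, mul_zero, h.2, smul_eq_mul]
  have h2 := h1.cmul (x ^ (q + 1))
  have ev : x ^ (q + 1) * (x⁻¹ * c) = c * x ^ q := by
    rw [Real.rpow_add hx, Real.rpow_one]; field_simp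
  rw [ev] at h2
  have ef : ∀ t ∈ Set.Ioi (0:ℝ), x ^ (q + 1) * ((x * t) ^ (-q - 1) * φ (x * t)) =
      t ^ (-q - 1) * φ (t * x) := by
    intro t ht
    have ht : 0 < t := ht
    rw [Real.mul_rpow hx.le ht.le, mul_comm t x, ← mul_assoc, ← mul_assoc, ← Real.rpow_add hx]
    have : q + 1 + (-q - 1) = 0 := by ring
    rw [this, Real.rpow_zero, one_mul]
  exact ⟨h2.1.congr_fun ef measurableSet_Ioi,
    by rw [← MeasureTheory.setIntegral_congr_fun measurableSet_Ioi ef, h2.2]⟩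

lemma rep_neg {q : ℝ} (hq : q < 0) :
    ∃ c, 0 < c ∧ Rep (fun t => t ^ (-q - 1) * Real.exp (-t)) c := by
  have hq' : 0 < -q := by linarith
  refine ⟨Real.Gamma (-q), Real.Gamma_pos_of_pos hq', ?_, ?_⟩
  · refine (Real.GammaIntegral_convergent hq').congr_fun (fun t _ => ?_) measurableSet_Ioi
    simp only [mul_comm]
  · rw [Real.Gamma_eq_integral hq']
    simp only [mul_comm]

lemma rep_mid {q : ℝ} (hq1 : 1 < q) (hq2 : q < 2) :
    ∃ c, 0 < c ∧ Rep (fun t => t ^ (-q - 1) * (Real.exp (-t) - 1 + t)) c := by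
  have hnn : ∀ t : ℝ, t ≠ 0 → 0 < Real.exp (-t) - 1 + t := fun t ht => by
    have := Real.add_one_lt_exp (x := -t) (by simpa using ht); linarith
  have hmeas : ∀ s : Set ℝ, MeasureTheory.AEStronglyMeasurable
      (fun t : ℝ => t ^ (-q - 1) * (Real.exp (-t) - 1 + t)) (MeasureTheory.volume.restrict s) := by
    intro s
    apply Measurable.aestronglyMeasurable
    fun_prop
  have hintg : MeasureTheory.IntegrableOn (fun t : ℝ => t ^ (-q - 1) * (Real.exp (-t) - 1 + t))
      (Set.Ioi 0) := by
    rw [← Set.Ioc_union_Ioi_eq_Ioi (zero_le_one (α := ℝ))]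
    refine MeasureTheory.IntegrableOn.union ?_ ?_
    · have h1 : MeasureTheory.IntegrableOn (fun t : ℝ => t ^ (1 - q)) (Set.Ioc 0 1) := by
        rw [← intervalIntegrable_iff_integrableOn_Ioc_of_le zero_le_one]
        exact intervalIntegral.intervalIntegrable_rpow' (by linarith)
      refine MeasureTheory.Integrable.mono' h1 (hmeas _) ?_
      refine (MeasureTheory.ae_restrict_iff' measurableSet_Ioc).mpr (Filter.Eventually.of_forall ?_)
      rintro t ⟨h0, h1⟩
      rw [Real.norm_of_nonneg (mul_nonneg (Real.rpow_nonneg h0.le _) (hnn t h0.ne').le)]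
      have e : t ^ (1 - q) = t ^ (-q - 1) * t ^ 2 := by
        rw [← Real.rpow_natCast, ← Real.rpow_add h0]; congr 1; push_cast; ring
      rw [e]
      gcongr
      have := Real.abs_exp_sub_one_sub_id_le (x := -t) (by rw [abs_neg, abs_of_pos h0]; exact h1)
      have := le_of_abs_le this
      nlinarith
    · have h1 := integrableOn_Ioi_rpow_of_lt (show -q < -1 by linarith) zero_lt_one
      refine MeasureTheory.Integrable.mono' h1 (hmeas _) ?_
      refine (MeasureTheory.ae_restrict_iff' measurableSet_Ioi).mpr (Filter.Eventually.of_forall ?_)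
      intro t ht
      have h0 : 0 < t := lt_trans one_pos ht
      rw [Real.norm_of_nonneg (mul_nonneg (Real.rpow_nonneg h0.le _) (hnn t h0.ne').le)]
      have e : t ^ (-q) = t ^ (-q - 1) * t := by
        rw [← Real.rpow_add_one h0.ne']; congr 1; ring
      rw [e]
      gcongr
      have : Real.exp (-t) < 1 := Real.exp_lt_one_iff.mpr (by linarith)
      linarith
  refine ⟨_, ?_, hintg, rfl⟩
  rw [MeasureTheory.setIntegral_pos_iff_support_of_nonneg_ae]
  · have : Set.Ioi (0:ℝ) ⊆ Function.support (fun t : ℝ => t ^ (-q - 1) * (Real.exp (-t) - 1 + t)) := by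
      intro t ht
      have ht : 0 < t := ht
      exact (mul_pos (Real.rpow_pos_of_pos ht _) (hnn t ht.ne')).ne'
    rw [Set.inter_eq_right.mpr this]
    simp
  · refine (MeasureTheory.ae_restrict_iff' measurableSet_Ioi).mpr (Filter.Eventually.of_forall ?_)
    intro t ht
    have ht : 0 < t := ht
    exact (mul_pos (Real.rpow_pos_of_pos ht _) (hnn t ht.ne')).le
  · exact hintg

lemma integrate {A B : Matrix (Fin n) (Fin n) ℂ} (hA : A.PosDef) (hB : B.PosDef)
    (hC : (A + B).PosDef) {q c : ℝ} {φ : ℝ → ℝ} (hc : 0 < c)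
    (hφ : Rep (fun t => t ^ (-q - 1) * φ t) c)
    (hpt : ∀ t, 0 < t → ∑ k, φ (t * hC.isHermitian.eigenvalues k)
      - ∑ i, φ (t * hA.isHermitian.eigenvalues i)
      - ∑ i, φ (t * hB.isHermitian.eigenvalues i)
      ≤ ∑ i, ∑ j, wt hA.isHermitian hB.isHermitian i j *
        (φ (t * (2 * √(hA.isHermitian.eigenvalues i * hB.isHermitian.eigenvalues j)))
        - 2 * φ (t * √(hA.isHermitian.eigenvalues i * hB.isHermitian.eigenvalues j)))) :
    ∑ k, (hC.isHermitian.eigenvalues k) ^ q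
      - ∑ i, (hA.isHermitian.eigenvalues i) ^ q
      - ∑ i, (hB.isHermitian.eigenvalues i) ^ q
      ≤ (2 ^ q - 2) * ∑ i, ∑ j, wt hA.isHermitian hB.isHermitian i j *
        (hA.isHermitian.eigenvalues i ^ (q / 2) * hB.isHermitian.eigenvalues j ^ (q / 2)) := by
  have apos := hA.eigenvalues_pos
  have bpos := hB.eigenvalues_pos
  have cpos := hC.eigenvalues_pos
  set a := hA.isHermitian.eigenvalues
  set b := hB.isHermitian.eigenvalues
  set l := hC.isHermitian.eigenvalues
  set w := wt hA.isHermitian hB.isHermitian with hw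
  have gpos : ∀ i j, 0 < √(a i * b j) := fun i j => Real.sqrt_pos.mpr (mul_pos (apos i) (bpos j))
  have L := ((Rep.sum fun k => hφ.scale (cpos k)).sub (Rep.sum fun k => hφ.scale (apos k))).sub
    (Rep.sum fun k => hφ.scale (bpos k))
  have R := Rep.sum fun i => Rep.sum fun j =>
    ((hφ.scale (mul_pos two_pos (gpos i j))).sub ((hφ.scale (gpos i j)).cmul 2)).cmul (w i j)
  have key := L.mono R (fun t ht => by
    have h := mul_le_mul_of_nonneg_left (hpt t ht) (Real.rpow_nonneg ht.le (-q - 1))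
    refine le_of_eq_of_le ?_ (h.trans_eq ?_)
    · simp only [mul_sub, Finset.mul_sum]
    · simp only [Finset.mul_sum]
      refine Finset.sum_congr rfl fun i _ => Finset.sum_congr rfl fun j _ => ?_
      ring)
  have e1 : ∀ i j, w i j * (c * (2 * √(a i * b j)) ^ q - 2 * (c * √(a i * b j) ^ q)) =
      c * ((2 ^ q - 2) * (w i j * (a i ^ (q / 2) * b j ^ (q / 2)))) := by
    intro i j
    have : √(a i * b j) ^ q = a i ^ (q / 2) * b j ^ (q / 2) := by
      rw [Real.sqrt_eq_rpow, ← Real.rpow_mul (mul_pos (apos i) (bpos j)).le,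
        ← Real.mul_rpow (apos i).le (bpos j).le]
      congr 1; ring
    rw [Real.mul_rpow two_pos.le (gpos i j).le, this]; ring
  simp only [e1] at key
  simp only [← Finset.mul_sum, ← mul_sub] at key
  exact le_of_mul_le_mul_left key hc

lemma eig_neg {A B : Matrix (Fin n) (Fin n) ℂ} (hA : A.PosDef) (hB : B.PosDef)
    (hC : (A + B).PosDef) {q : ℝ} (hq : q < 0) :
    ∑ k, (hC.isHermitian.eigenvalues k) ^ q
      - ∑ i, (hA.isHermitian.eigenvalues i) ^ q
      - ∑ i, (hB.isHermitian.eigenvalues i) ^ q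
      ≤ (2 ^ q - 2) * ∑ i, ∑ j, wt hA.isHermitian hB.isHermitian i j *
        (hA.isHermitian.eigenvalues i ^ (q / 2) * hB.isHermitian.eigenvalues j ^ (q / 2)) := by
  obtain ⟨c, hc, h⟩ := rep_neg hq
  exact integrate hA hB hC (φ := fun t => Real.exp (-t)) hc h fun t ht => pointwise hA hB hC ht

lemma sum_eig {A : Matrix (Fin n) (Fin n) ℂ} (hA : A.IsHermitian) :
    ((∑ i, hA.eigenvalues i : ℝ) : ℂ) = A.trace := by
  rw [← trace_cfc hA (fun x => x), cfc_id' ℝ A hA.isSelfAdjoint]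

lemma eig_mid {A B : Matrix (Fin n) (Fin n) ℂ} (hA : A.PosDef) (hB : B.PosDef)
    (hC : (A + B).PosDef) {q : ℝ} (hq1 : 1 < q) (hq2 : q < 2) :
    ∑ k, (hC.isHermitian.eigenvalues k) ^ q
      - ∑ i, (hA.isHermitian.eigenvalues i) ^ q
      - ∑ i, (hB.isHermitian.eigenvalues i) ^ q
      ≤ (2 ^ q - 2) * ∑ i, ∑ j, wt hA.isHermitian hB.isHermitian i j *
        (hA.isHermitian.eigenvalues i ^ (q / 2) * hB.isHermitian.eigenvalues j ^ (q / 2)) := by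
  obtain ⟨c, hc, h⟩ := rep_mid hq1 hq2
  refine integrate hA hB hC (φ := fun t => Real.exp (-t) - 1 + t) hc h fun t ht => ?_
  have hp := pointwise hA hB hC ht
  have htr : ∑ k, hC.isHermitian.eigenvalues k = ∑ i, hA.isHermitian.eigenvalues i +
      ∑ i, hB.isHermitian.eigenvalues i := by
    have : ((∑ k, hC.isHermitian.eigenvalues k : ℝ) : ℂ) =
      ((∑ i, hA.isHermitian.eigenvalues i + ∑ i, hB.isHermitian.eigenvalues i : ℝ) : ℂ) := by
      rw [sum_eig, Complex.ofReal_add, sum_eig, sum_eig, trace_add]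
    exact_mod_cast this
  have hw := wt_row hA.isHermitian hB.isHermitian
  set a := hA.isHermitian.eigenvalues
  set b := hB.isHermitian.eigenvalues
  set l := hC.isHermitian.eigenvalues
  set w := wt hA.isHermitian hB.isHermitian
  have e : ∑ i, ∑ j, w i j *
        ((Real.exp (-(t * (2 * √(a i * b j)))) - 1 + t * (2 * √(a i * b j)))
        - 2 * (Real.exp (-(t * √(a i * b j))) - 1 + t * √(a i * b j))) =
      ∑ i, ∑ j, w i j * (Real.exp (-(t * (2 * √(a i * b j)))) - 2 * Real.exp (-(t * √(a i * b j))))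
      + n := by
    have : (n : ℝ) = ∑ i, ∑ j, w i j := by simp [hw]
    rw [this, ← Finset.sum_add_distrib]
    refine Finset.sum_congr rfl fun i _ => ?_
    rw [← Finset.sum_add_distrib]
    refine Finset.sum_congr rfl fun j _ => ?_
    ring
  simp only [e]
  simp only [Finset.sum_add_distrib, Finset.sum_sub_distrib, ← Finset.mul_sum, htr]
  simp only [Finset.sum_const, Finset.card_univ, Fintype.card_fin, nsmul_eq_mul]
  linarith


section
variable {A B : Matrix (Fin n) (Fin n) ℂ}

lemma mR_add (hA : A.PosDef) (r s : ℝ) :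
    matrixRpow A r * matrixRpow A s = matrixRpow A (r + s) := by
  rw [← cp_real hA, ← cp_real hA, ← cp_real hA, cp_add]; push_cast; rfl

lemma mR_zero (hA : A.PosDef) : matrixRpow A 0 = 1 := by
  rw [← cp_real hA]; simpa using cp_zero hA.isHermitian

lemma mR_one (hA : A.IsHermitian) : matrixRpow A 1 = A := by
  rw [matrixRpow]
  simp only [Real.rpow_one]
  exact cfc_id' ℝ A hA.isSelfAdjoint

lemma mR_posDef (hA : A.PosDef) (r : ℝ) : (matrixRpow A r).PosDef := by
  rw [← cp_real hA]; exact cp_posDef hA r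

lemma mR_herm (A : Matrix (Fin n) (Fin n) ℂ) (r : ℝ) : (matrixRpow A r).IsHermitian :=
  IsSelfAdjoint.star_eq (cfc_predicate (R := ℝ) _ A)

lemma spec_pos (hA : A.PosDef) {x : ℝ} (hx : x ∈ spectrum ℝ A) : 0 < x := by
  rw [hA.isHermitian.spectrum_real_eq_range_eigenvalues] at hx
  obtain ⟨i, rfl⟩ := hx
  exact hA.eigenvalues_pos i

lemma mR_mR (hA : A.PosDef) (r s : ℝ) :
    matrixRpow (matrixRpow A r) s = matrixRpow A (r * s) := by
  unfold matrixRpow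
  rw [← cfc_comp (fun x : ℝ => x ^ s) (fun x : ℝ => x ^ r) A hA.isHermitian.isSelfAdjoint
    (by intro x hx
        obtain ⟨y, hy, rfl⟩ := hx
        exact (Real.continuousAt_rpow_const _ _
          (Or.inl (Real.rpow_pos_of_pos (spec_pos hA hy) _).ne')).continuousWithinAt)
    (by intro x hx
        exact (Real.continuousAt_rpow_const _ _ (Or.inl (spec_pos hA hx).ne')).continuousWithinAt)]
  apply cfc_congr
  intro x hx
  simp only [Function.comp]
  rw [Real.rpow_mul (spec_pos hA hx).le]

lemma mR_sandwich (hA : A.PosDef) (hB : B.PosDef) (r s : ℝ) :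
    (matrixRpow A r * matrixRpow B s * matrixRpow A r).PosDef := by
  rw [← cp_real hA, ← cp_real hB]; exact sandwich_posDef hA hB r s

lemma mR_trace (hA : A.IsHermitian) (r : ℝ) :
    (matrixRpow A r).trace.re = ∑ i, hA.eigenvalues i ^ r := by
  rw [matrixRpow, trace_cfc hA, Complex.ofReal_re]

lemma mR_trace_im (A : Matrix (Fin n) (Fin n) ℂ) (r : ℝ) : (matrixRpow A r).trace.im = 0 := by
  have h := congrArg Matrix.trace (mR_herm A r)
  rw [trace_conjTranspose] at h
  exact Complex.conj_eq_iff_im.mp h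

lemma alt' (hA : A.PosDef) (hB : B.PosDef) {θ p : ℝ} (hθ0 : 0 < θ) (hθ1 : θ ≤ 1) (hp : 1 ≤ p) :
    (matrixRpow (matrixRpow A (θ / 2) * matrixRpow B θ * matrixRpow A (θ / 2))
      (p / (2 * θ))).trace.re ≤
    (matrixRpow (matrixRpow A (1 / 2) * B * matrixRpow A (1 / 2)) (p / 2)).trace.re := by
  have hP := mR_sandwich hA hB (θ / 2) θ
  have hQ := mR_sandwich hA hB (1 / 2) 1
  rw [mR_one hB.isHermitian] at hQ
  rw [mR_trace hP.isHermitian, mR_trace hQ.isHermitian]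
  refine alt hA hB hP hQ hθ0 hθ1 hp ?_ ?_
  · rw [cp_real hA, cp_real hB]
  · rw [cp_real hA]

/-- common reduction to the eigenvalue inequality -/
lemma mR_trace_prod (hA : A.PosDef) (hB : B.PosDef) (r : ℝ) :
    (matrixRpow A r * matrixRpow B r).trace.re = ∑ i, ∑ j, wt hA.isHermitian hB.isHermitian i j *
        (hA.isHermitian.eigenvalues i ^ r * hB.isHermitian.eigenvalues j ^ r) := by
  rw [matrixRpow, matrixRpow, trace_prod hA.isHermitian hB.isHermitian, Complex.ofReal_re]

lemma case_neg (hA : A.PosDef) (hB : B.PosDef) {q : ℝ} (hq : q ≤ -2) :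
    (matrixRpow (A + B) q).trace.re - (matrixRpow A q).trace.re - (matrixRpow B q).trace.re ≤
      (2 ^ q - 2) *
        (matrixRpow (matrixRpow A (1 / 2) * B * matrixRpow A (1 / 2)) (q / 2)).trace.re := by
  have hC := hA.add hB
  have h := eig_neg hA hB hC (show q < 0 by linarith)
  rw [← mR_trace, ← mR_trace, ← mR_trace, ← mR_trace_prod hA hB] at h
  have hR := mR_sandwich hA hB (1 / 2) 1
  rw [mR_one hB.isHermitian] at hR
  have hq0 : q ≠ 0 := by linarith
  have k := alt' (mR_posDef hA (q / 2)) (mR_posDef hB (q / 2)) (θ := -2 / q) (p := 2)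
    (div_pos_of_neg_of_neg (by norm_num) (by linarith))
    (by rw [div_le_one_of_neg (by linarith)]; exact hq) (by norm_num)
  rw [mR_mR hA, mR_mR hB, mR_mR hA] at k
  have e1 : q / 2 * (-2 / q / 2) = -(1 / 2) := by field_simp
  have e2 : q / 2 * (-2 / q) = -1 := by field_simp
  have e3 : 2 / (2 * (-2 / q)) = -1 * (q / 2) := by field_simp
  have e4 : q / 2 * (1 / 2) = q / 4 := by ring
  have e5 : (2:ℝ) / 2 = 1 := by norm_num
  rw [e1, e2, e3, e4, e5] at k
  have inv : matrixRpow A (-(1 / 2)) * matrixRpow B (-1) * matrixRpow A (-(1 / 2)) =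
      matrixRpow (matrixRpow A (1 / 2) * B * matrixRpow A (1 / 2)) (-1) := by
    have i1 : (matrixRpow A (1 / 2) * B * matrixRpow A (1 / 2)) *
      matrixRpow (matrixRpow A (1 / 2) * B * matrixRpow A (1 / 2)) (-1) = 1 := by
      have := mR_add hR 1 (-1)
      rwa [mR_one hR.isHermitian, add_neg_cancel, mR_zero hR] at this
    have i2 : (matrixRpow A (-(1 / 2)) * matrixRpow B (-1) * matrixRpow A (-(1 / 2))) *
        (matrixRpow A (1 / 2) * B * matrixRpow A (1 / 2)) = 1 := by
      have a1 : matrixRpow A (-(1 / 2)) * matrixRpow A (1 / 2) = 1 := by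
        rw [mR_add hA, neg_add_cancel, mR_zero hA]
      have b1 : matrixRpow B (-1) * B = 1 := by
        have := mR_add hB (-1) 1
        rwa [mR_one hB.isHermitian, neg_add_cancel, mR_zero hB] at this
      calc _ = matrixRpow A (-(1 / 2)) * (matrixRpow B (-1) *
            (matrixRpow A (-(1 / 2)) * matrixRpow A (1 / 2)) * B) * matrixRpow A (1 / 2) := by
            simp only [mul_assoc]
        _ = 1 := by rw [a1, mul_one, b1, mul_one, a1]
    exact left_inv_eq_right_inv i2 i1
  have t1 : (matrixRpow (matrixRpow A (q / 4) * matrixRpow B (q / 2) * matrixRpow A (q / 4)) 1).trace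
      = (matrixRpow A (q / 2) * matrixRpow B (q / 2)).trace := by
    rw [mR_one (mR_sandwich hA hB _ _).isHermitian, mul_assoc, trace_mul_comm, mul_assoc, mR_add hA,
      trace_mul_comm]
    congr 3; ring
  rw [inv, mR_mR hR, t1] at k
  rw [show -1 * (-1 * (q / 2)) = q / 2 by ring] at k
  refine h.trans (mul_le_mul_of_nonpos_left k ?_)
  have : (2:ℝ) ^ q ≤ 1 := Real.rpow_le_one_of_one_le_of_nonpos (by norm_num) (by linarith)
  linarith

lemma case_mid (hA : A.PosDef) (hB : B.PosDef) {q : ℝ} (hq1 : 1 < q) (hq2 : q < 2) :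
    (matrixRpow (A + B) q).trace.re - (matrixRpow A q).trace.re - (matrixRpow B q).trace.re ≤
      (2 ^ q - 2) *
        (matrixRpow (matrixRpow A (1 / 2) * B * matrixRpow A (1 / 2)) (q / 2)).trace.re := by
  have hC := hA.add hB
  have h := eig_mid hA hB hC hq1 hq2
  rw [← mR_trace, ← mR_trace, ← mR_trace, ← mR_trace_prod hA hB] at h
  have k := alt' hA hB (θ := q / 2) (p := q) (by linarith) (by linarith) (by linarith)
  have e1 : q / (2 * (q / 2)) = 1 := by field_simp
  rw [e1] at k
  have t1 : (matrixRpow (matrixRpow A (q / 2 / 2) * matrixRpow B (q / 2) *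
      matrixRpow A (q / 2 / 2)) 1).trace
      = (matrixRpow A (q / 2) * matrixRpow B (q / 2)).trace := by
    rw [mR_one (mR_sandwich hA hB _ _).isHermitian, mul_assoc, trace_mul_comm, mul_assoc, mR_add hA,
      trace_mul_comm]
    congr 3; ring
  rw [t1] at k
  refine h.trans (mul_le_mul_of_nonneg_left k ?_)
  have : (2:ℝ) ^ (1:ℝ) ≤ 2 ^ q := Real.rpow_le_rpow_of_exponent_le (by norm_num) hq1.le
  rw [Real.rpow_one] at this
  linarith

section
open scoped Matrix.Norms.L2Operator
lemma mR_cont {X : ℝ → Matrix (Fin n) (Fin n) ℂ} (hX : Continuous X)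
    (hh : ∀ t, (X t).IsHermitian) {r : ℝ} (hr : 0 ≤ r) :
    Continuous (fun t => matrixRpow (X t) r) := by
  unfold matrixRpow
  exact Continuous.cfc_of_mem_nhdsSet (s := Set.univ) (fun x : ℝ => x ^ r) (by simp) hX
    (fun t => (hh t).isSelfAdjoint) (Real.continuous_rpow_const hr).continuousOn
end

lemma case_mid' (hA : A.PosSemidef) (hB : B.PosSemidef) {q : ℝ} (hq1 : 1 < q) (hq2 : q < 2) :
    (matrixRpow (A + B) q).trace.re - (matrixRpow A q).trace.re - (matrixRpow B q).trace.re ≤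
      (2 ^ q - 2) *
        (matrixRpow (matrixRpow A (1 / 2) * B * matrixRpow A (1 / 2)) (q / 2)).trace.re := by
  have herm : ∀ {X : Matrix (Fin n) (Fin n) ℂ}, X.IsHermitian → ∀ t : ℝ,
      (X + (t : ℂ) • (1 : Matrix (Fin n) (Fin n) ℂ)).IsHermitian := by
    intro X hX t
    refine hX.add ?_
    rw [Matrix.IsHermitian, conjTranspose_smul, conjTranspose_one]
    simp
  have pd : ∀ {X : Matrix (Fin n) (Fin n) ℂ}, X.PosSemidef → ∀ t : ℝ, 0 < t →
      (X + (t : ℂ) • (1 : Matrix (Fin n) (Fin n) ℂ)).PosDef := by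
    intro X hX t ht
    refine PosDef.posSemidef_add hX (PosDef.one.smul ?_)
    exact_mod_cast ht
  have cont : ∀ X : Matrix (Fin n) (Fin n) ℂ, Continuous (fun t : ℝ =>
      X + (t : ℂ) • (1 : Matrix (Fin n) (Fin n) ℂ)) := by
    intro X; fun_prop
  have tr : ∀ {Y : ℝ → Matrix (Fin n) (Fin n) ℂ}, Continuous Y →
      Continuous (fun t => (Y t).trace.re) := fun hY => Complex.continuous_re.comp hY.matrix_trace
  have hAc := cont A
  have hBc := cont B
  have hAh := herm hA.isHermitian
  have hBh := herm hB.isHermitian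
  have L : Continuous fun t : ℝ => (matrixRpow ((A + (t : ℂ) • 1) + (B + (t : ℂ) • 1)) q).trace.re -
      (matrixRpow (A + (t : ℂ) • 1) q).trace.re - (matrixRpow (B + (t : ℂ) • 1) q).trace.re :=
    ((tr (mR_cont (hAc.add hBc) (fun t => (hAh t).add (hBh t)) (by linarith))).sub
      (tr (mR_cont hAc hAh (by linarith)))).sub (tr (mR_cont hBc hBh (by linarith)))
  have R : Continuous fun t : ℝ => (2 ^ q - 2) * (matrixRpow (matrixRpow (A + (t : ℂ) • 1) (1 / 2) *
      (B + (t : ℂ) • 1) * matrixRpow (A + (t : ℂ) • 1) (1 / 2)) (q / 2)).trace.re := by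
    have s := mR_cont hAc hAh (show (0:ℝ) ≤ 1 / 2 by norm_num)
    refine continuous_const.mul (tr (mR_cont ((s.mul hBc).mul s) (fun t => ?_) (by linarith)))
    show (matrixRpow (A + (t : ℂ) • 1) (1 / 2) *
      (B + (t : ℂ) • 1) * matrixRpow (A + (t : ℂ) • 1) (1 / 2))ᴴ = matrixRpow (A + (t : ℂ) • 1) (1 / 2) *
      (B + (t : ℂ) • 1) * matrixRpow (A + (t : ℂ) • 1) (1 / 2)
    rw [conjTranspose_mul, conjTranspose_mul, (mR_herm _ _).eq, (hBh t).eq, mul_assoc]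
  have L0 := (L.tendsto 0).mono_left (nhdsWithin_le_nhds (s := Set.Ioi 0))
  have R0 := (R.tendsto 0).mono_left (nhdsWithin_le_nhds (s := Set.Ioi 0))
  have := le_of_tendsto_of_tendsto L0 R0 (by
    filter_upwards [self_mem_nhdsWithin] with t ht
    exact case_mid (pd hA t ht) (pd hB t ht) hq1 hq2)
  simpa using this

lemma mR_nat (hA : A.IsHermitian) : matrixRpow A 2 = A * A := by
  rw [← pow_two, ← cfc_pow_id (R := ℝ) A 2 hA.isSelfAdjoint, matrixRpow]
  congr 1; ext x; exact_mod_cast Real.rpow_natCast x 2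

lemma case_two (hA : A.PosSemidef) (hB : B.PosSemidef) :
    (matrixRpow (A + B) 2).trace - (matrixRpow A 2).trace - (matrixRpow B 2).trace =
      2 * (matrixRpow (matrixRpow A (1 / 2) * B * matrixRpow A (1 / 2)) 1).trace := by
  have hA' := hA.isHermitian
  have hB' := hB.isHermitian
  have hh : (matrixRpow A (1 / 2) * B * matrixRpow A (1 / 2)).IsHermitian := by
    rw [Matrix.IsHermitian, conjTranspose_mul, conjTranspose_mul, (mR_herm _ _).eq, hB'.eq,
      mul_assoc]
  have sq : matrixRpow A (1 / 2) * matrixRpow A (1 / 2) = A := by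
    unfold matrixRpow
    rw [cfc_eq_hc hA', hc_mul]
    conv_rhs => rw [← hc_id hA']
    apply hc_congr
    intro i
    rw [← Complex.ofReal_mul, ← Real.sqrt_eq_rpow, Real.mul_self_sqrt (hA.eigenvalues_nonneg i)]
  rw [mR_one hh, mul_assoc, trace_mul_comm, mul_assoc, sq, mR_nat hA', mR_nat hB',
    mR_nat (hA'.add hB'), add_mul, mul_add, mul_add, trace_add, trace_add, trace_add,
    trace_mul_comm A B]
  ring
end

end TraceAux

/-- Corollary 4.3, second part: if either `q ≤ -2` and `A, B` are positive definite, or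
`1 ≤ q ≤ 2` and `A, B` are positive semidefinite, then
`Tr((A+B)^q) - Tr(A^q) - Tr(B^q) ≤ (2^q - 2)·Tr((A^{1/2}·B·A^{1/2})^{q/2})`. -/
theorem trace_rpow_alt_inequality_reversed {n : ℕ}
    (A B : Matrix (Fin n) (Fin n) ℂ) (q : ℝ)
    (hq : (q ≤ -2 ∧ A.PosDef ∧ B.PosDef) ∨ (1 ≤ q ∧ q ≤ 2 ∧ A.PosSemidef ∧ B.PosSemidef)) :
    (matrixRpow (A + B) q).trace - (matrixRpow A q).trace - (matrixRpow B q).trace ≤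
      ((2 ^ q - 2 : ℝ) : ℂ) *
        (matrixRpow (matrixRpow A (1 / 2) * B * matrixRpow A (1 / 2)) (q / 2)).trace := by
  rw [Complex.le_def]
  constructor
  swap
  · simp [TraceAux.mR_trace_im]
  rw [Complex.sub_re, Complex.sub_re, Complex.re_ofReal_mul]
  rcases hq with ⟨hq, hA, hB⟩ | ⟨h1, h2, hA, hB⟩
  · exact TraceAux.case_neg hA hB hq
  · rcases h1.eq_or_lt with rfl | h1
    · rw [TraceAux.mR_one hA.isHermitian, TraceAux.mR_one hB.isHermitian,
        TraceAux.mR_one (hA.isHermitian.add hB.isHermitian), Matrix.trace_add]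
      simp
    rcases h2.eq_or_lt with rfl | h2
    · have := congrArg Complex.re (TraceAux.case_two hA hB)
      rw [Complex.sub_re, Complex.sub_re] at this
      rw [this, show (2:ℝ) / 2 = 1 by norm_num, show (2:ℝ) ^ (2:ℝ) - 2 = 2 by norm_num]
      simp
    · exact TraceAux.case_mid' hA hB h1 h2
end
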